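/- arXiv:2308.04174 — 11 statements merged into one kernel-verified Lean document; each statement's English description precedes it below -/
import Mathlib

section
/- Let V be a finite set of cardinality |V| and let f : V × V × ℝ_{>0} → ℝ be integrable in t on every interval (0,t₀]. Suppose there are a constant C and an integer k ≥ 0 such that |f(x,y;t)| ≤ C t^k for all x, y ∈ V and 0 < t < t₀. Then for every integer ℓ ≥ 1 and all x, y ∈ V, 0 < t < t₀, the ℓ-fold convolution satisfies |f^{∗ℓ}(x,y;t)| ≤ (C k!)^ℓ |V|^{ℓ−1} t^{ℓk+ℓ−1}/(ℓk+ℓ−1)!. -/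
open MeasureTheory

/-- The graph convolution of two functions `V × V × ℝ → ℝ` on a finite vertex set `V`. -/
noncomputable def graphConv {V : Type*} [Fintype V] (F₁ F₂ : V → V → ℝ → ℝ) :
    V → V → ℝ → ℝ :=
  fun x y t => ∫ r in (0:ℝ)..t, ∑ v : V, F₁ x v (t - r) * F₂ v y r

/-- `iterConv f n` is the `(n+1)`-fold convolution `f^{∗(n+1)}`:
`iterConv f 0 = f^{∗1} = f` and `iterConv f (n+1) = (iterConv f n) ∗ f`. -/
noncomputable def iterConv {V : Type*} [Fintype V] (f : V → V → ℝ → ℝ) :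
    ℕ → V → V → ℝ → ℝ
  | 0 => f
  | n + 1 => graphConv (iterConv f n) f

theorem beta_nat (t : ℝ) (a : ℕ) : ∀ b : ℕ,
    ∫ r in (0:ℝ)..t, (t - r) ^ a * r ^ b =
      (a.factorial : ℝ) * b.factorial / ((a + b + 1).factorial : ℝ) * t ^ (a + b + 1) := by
  induction a with
  | zero =>
    intro b
    simp only [pow_zero, one_mul, integral_pow, Nat.factorial_zero, Nat.cast_one, zero_add]
    rw [Nat.factorial_succ]
    have : (b.factorial : ℝ) ≠ 0 := by positivity
    push_cast
    field_simp
    simp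
  | succ a ih =>
    intro b
    have hd : ∀ r ∈ Set.uIcc 0 t, HasDerivAt (fun r : ℝ => (t - r) ^ (a + 1) * r ^ (b + 1))
        (((b : ℝ) + 1) * ((t - r) ^ (a + 1) * r ^ b)
          - ((a : ℝ) + 1) * ((t - r) ^ a * r ^ (b + 1))) r := by
      intro r _
      have h1 := (((hasDerivAt_id' r).const_sub t).fun_pow (a + 1)).fun_mul
        ((hasDerivAt_id' r).fun_pow (b + 1))
      refine h1.congr_deriv ?_
      simp only [Nat.add_sub_cancel]
      push_cast
      ring
    have h2 := intervalIntegral.integral_eq_sub_of_hasDerivAt hd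
      (Continuous.intervalIntegrable (by fun_prop) _ _)
    rw [intervalIntegral.integral_sub (Continuous.intervalIntegrable (by fun_prop) _ _)
      (Continuous.intervalIntegrable (by fun_prop) _ _),
      intervalIntegral.integral_const_mul, intervalIntegral.integral_const_mul, ih (b + 1)] at h2
    have e : a + (b + 1) + 1 = a + 1 + b + 1 := by ring
    rw [e] at h2
    simp only [sub_self, ne_eq, Nat.add_eq_zero_iff, one_ne_zero, and_false, not_false_eq_true,
      zero_pow, zero_mul, mul_zero] at h2
    have hb : ((b : ℝ) + 1) ≠ 0 := by positivity
    apply mul_left_cancel₀ hb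
    rw [sub_eq_zero.mp h2, Nat.factorial_succ a, Nat.factorial_succ b]
    push_cast
    ring

/-- Bound for the `ℓ`-fold convolution: for `ℓ = n + 1 ≥ 1`,
`|f^{∗ℓ}(x,y;t)| ≤ (C k!)^ℓ |V|^{ℓ−1} t^{ℓk+ℓ−1}/(ℓk+ℓ−1)!`. -/
theorem iterConv_bound {V : Type*} [Fintype V]
    (f : V → V → ℝ → ℝ) (t₀ : ℝ) (ht₀ : 0 < t₀)
    (hInt : ∀ x y : V, IntegrableOn (f x y) (Set.Ioc 0 t₀))
    (C : ℝ) (k : ℕ)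
    (hf : ∀ (x y : V) (t : ℝ), 0 < t → t < t₀ → |f x y t| ≤ C * t ^ k)
    (n : ℕ) (x y : V) (t : ℝ) (ht : 0 < t) (htt₀ : t < t₀) :
    |iterConv f n x y t| ≤
      (C * (k.factorial : ℝ)) ^ (n + 1) * (Fintype.card V : ℝ) ^ n *
        t ^ ((n + 1) * k + n) / (((n + 1) * k + n).factorial : ℝ) := by
  have hC : 0 ≤ C := by
    have h := (abs_nonneg _).trans (hf x y t ht htt₀)
    exact nonneg_of_mul_nonneg_left h (by positivity)
  induction n generalizing x y t with
  | zero =>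
    have hk : (k.factorial : ℝ) ≠ 0 := by positivity
    have := hf x y t ht htt₀
    simp only [iterConv, zero_add, one_mul, pow_one, pow_zero, mul_one, add_zero]
    refine this.trans (le_of_eq ?_)
    field_simp
  | succ n ih =>
    set m := (n + 1) * k + n with hm
    set D := (C * (k.factorial : ℝ)) ^ (n + 1) * (Fintype.card V : ℝ) ^ n / (m.factorial : ℝ)
      with hD
    have hD0 : 0 ≤ D := by positivity
    have key : ‖∫ r in (0:ℝ)..t, ∑ v : V, iterConv f n x v (t - r) * f v y r‖ ≤
        ∫ r in (0:ℝ)..t, ((Fintype.card V : ℝ) * D * C) * ((t - r) ^ m * r ^ k) := by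
      apply intervalIntegral.norm_integral_le_of_norm_le ht.le
      · have hne : ∀ᵐ r : ℝ, r ≠ t := by simp [ae_iff]
        filter_upwards [hne] with r hr hrt
        have hr1 : r < t := lt_of_le_of_ne hrt.2 hr
        have hr0 : 0 < r := hrt.1
        calc ‖∑ v : V, iterConv f n x v (t - r) * f v y r‖
            ≤ ∑ v : V, ‖iterConv f n x v (t - r) * f v y r‖ := norm_sum_le _ _
          _ ≤ ∑ v : V, (D * (t - r) ^ m) * (C * r ^ k) := by
              apply Finset.sum_le_sum
              intro v _
              rw [norm_mul]
              have h1 := ih x v (t - r) (by linarith) (by linarith)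
              have h2 := hf v y r hr0 (by linarith)
              have h3 : (0:ℝ) ≤ (t - r) ^ m := pow_nonneg (by linarith) _
              refine mul_le_mul (h1.trans (le_of_eq ?_)) h2 (norm_nonneg _) (by positivity)
              rw [hD]
              ring
          _ = _ := by
              rw [Finset.sum_const, nsmul_eq_mul, Finset.card_univ]
              ring
      · exact Continuous.intervalIntegrable (by fun_prop) _ _
    rw [intervalIntegral.integral_const_mul, beta_nat] at key
    have e : (n + 1 + 1) * k + (n + 1) = m + k + 1 := by rw [hm]; ring
    rw [e]
    refine key.trans (le_of_eq ?_)
    have hmf : (m.factorial : ℝ) ≠ 0 := by positivity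
    rw [hD]
    field_simp
    ring
end

section
/- Let V be a finite set and let f : V × V × ℝ_{>0} → ℝ be integrable in t on every interval (0,t₀], and suppose that for every t₀ > 0 there are a constant C and an integer k ≥ 0 with |f(x,y;t)| ≤ C t^k for all x, y ∈ V and 0 < t < t₀. Then the series F(x,y;t) = ∑_{ℓ=1}^∞ (−1)^ℓ f^{∗ℓ}(x,y;t) converges absolutely and uniformly on every compact subset of V × V × ℝ_{>0}, and moreover (f ∗ F)(x,y;t) = ∑_{ℓ=1}^∞ (−1)^ℓ f^{∗(ℓ+1)}(x,y;t) for all x, y ∈ V and t > 0. -/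
open MeasureTheory

namespace NeumannAux

/-- Full-line convolution on the reals. -/
noncomputable def cv (a b : ℝ → ℝ) : ℝ → ℝ := fun t => ∫ r, a (t - r) * b r

/-- Integrable, bounded, and vanishing on the nonpositive half-line. -/
def Good (h : ℝ → ℝ) : Prop :=
  Integrable h ∧ (∃ B, ∀ t, ‖h t‖ ≤ B) ∧ (∀ t, t ≤ 0 → h t = 0)

theorem cv_eq (a b : ℝ → ℝ) :
    cv a b = MeasureTheory.convolution a b (ContinuousLinearMap.mul ℝ ℝ) volume := by
  funext t
  exact (convolution_mul_swap (μ := volume) (f := a) (g := b) (x := t)).symm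

theorem Good.integrable_mul {a b : ℝ → ℝ} (ha : Good a) (hb : Good b) (t : ℝ) :
    Integrable (fun r => a (t - r) * b r) := by
  obtain ⟨hai, ⟨B, hB⟩, -⟩ := ha
  exact hb.1.bdd_mul (c := B) (hai.comp_sub_left t).aestronglyMeasurable
    (Filter.Eventually.of_forall fun r => hB _)

theorem integrable_mul' {a b : ℝ → ℝ} (ha : Integrable a) (haB : ∃ B, ∀ t, ‖a t‖ ≤ B)
    (hb : Integrable b) (t : ℝ) :
    Integrable (fun r => a r * b (t - r)) := by
  obtain ⟨B, hB⟩ := haB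
  exact (hb.comp_sub_left t).bdd_mul (c := B) ha.aestronglyMeasurable
    (Filter.Eventually.of_forall fun r => hB _)

theorem Good.cv {a b : ℝ → ℝ} (ha : Good a) (hb : Good b) : Good (cv a b) := by
  refine ⟨?_, ?_, ?_⟩
  · rw [cv_eq]
    exact Integrable.integrable_convolution _ ha.1 hb.1
  · obtain ⟨hai, ⟨B, hB⟩, -⟩ := ha
    refine ⟨∫ r, B * ‖b r‖, fun t => ?_⟩
    refine norm_integral_le_of_norm_le (hb.1.norm.const_mul B)
      (Filter.Eventually.of_forall fun r => ?_)
    rw [norm_mul]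
    exact mul_le_mul_of_nonneg_right (hB _) (norm_nonneg _)
  · intro t ht
    have : (fun r => a (t - r) * b r) = fun _ => 0 := by
      funext r
      rcases le_total r 0 with h | h
      · rw [hb.2.2 r h, mul_zero]
      · rw [ha.2.2 (t - r) (by linarith), zero_mul]
    simp [NeumannAux.cv, this]

theorem Good.sum {ι : Type*} (s : Finset ι) {a : ι → ℝ → ℝ} (ha : ∀ i, Good (a i)) :
    Good (fun t => ∑ i ∈ s, a i t) := by
  refine ⟨integrable_finsetSum s fun i _ => (ha i).1, ?_, ?_⟩
  · choose B hB using fun i => (ha i).2.1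
    exact ⟨∑ i ∈ s, B i, fun t => norm_sum_le_of_le s fun i _ => hB i t⟩
  · intro t ht
    exact Finset.sum_eq_zero fun i _ => (ha i).2.2 t ht

theorem cv_interval {a b : ℝ → ℝ} (ha : Good a) (hb : Good b) {t : ℝ} (ht : 0 ≤ t) :
    cv a b t = ∫ r in (0:ℝ)..t, a (t - r) * b r := by
  rw [intervalIntegral.integral_of_le ht, cv]
  symm
  refine setIntegral_eq_integral_of_forall_compl_eq_zero fun r hr => ?_
  rcases le_or_gt r 0 with h | h
  · rw [hb.2.2 r h, mul_zero]
  · have : t < r := by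
      by_contra hc
      exact hr ⟨h, not_lt.mp hc⟩
    rw [ha.2.2 (t - r) (by linarith), zero_mul]

theorem cv_assoc {a b c : ℝ → ℝ} (ha : Good a) (hb : Good b) (hc : Good c) :
    cv (cv a b) c = cv a (cv b c) := by
  funext t
  have hn : ∀ {h : ℝ → ℝ}, Good h → ∃ B, ∀ t, ‖‖h t‖‖ ≤ B := by
    intro h hh
    obtain ⟨B, hB⟩ := hh.2.1
    exact ⟨B, fun t => by simpa using hB t⟩
  simp only [cv_eq]
  refine convolution_assoc (ContinuousLinearMap.mul ℝ ℝ) (ContinuousLinearMap.mul ℝ ℝ)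
    (ContinuousLinearMap.mul ℝ ℝ) (ContinuousLinearMap.mul ℝ ℝ) ?_
    ha.1.aestronglyMeasurable hb.1.aestronglyMeasurable hc.1.aestronglyMeasurable ?_ ?_ ?_
  · intro x y z
    simp [mul_assoc]
  · exact Filter.Eventually.of_forall fun y => integrable_mul' ha.1 ha.2.1 hb.1 y
  · exact Filter.Eventually.of_forall fun y => integrable_mul' hb.1.norm (hn hb) hc.1.norm y
  · exact integrable_mul' ha.1.norm (hn ha)
      (Integrable.integrable_convolution _ hb.1.norm hc.1.norm) t

theorem cv_sum_left {ι : Type*} (s : Finset ι) {a : ι → ℝ → ℝ} {b : ℝ → ℝ}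
    (ha : ∀ i, Good (a i)) (hb : Good b) (t : ℝ) :
    cv (fun t => ∑ i ∈ s, a i t) b t = ∑ i ∈ s, cv (a i) b t := by
  simp only [cv, Finset.sum_mul]
  exact integral_finsetSum s fun i _ => (ha i).integrable_mul hb t

theorem cv_sum_right {ι : Type*} (s : Finset ι) {a : ι → ℝ → ℝ} {b : ℝ → ℝ}
    (ha : ∀ i, Good (a i)) (hb : Good b) (t : ℝ) :
    cv b (fun t => ∑ i ∈ s, a i t) t = ∑ i ∈ s, cv b (a i) t := by
  simp only [cv, Finset.mul_sum]
  exact integral_finsetSum s fun i _ => hb.integrable_mul (ha i) t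

variable {V : Type*} [Fintype V]

/-- Iterated full-line matrix convolution. -/
noncomputable def G (g : V → V → ℝ → ℝ) : ℕ → V → V → ℝ → ℝ
  | 0 => g
  | n + 1 => fun x y t => ∑ v, cv (G g n x v) (g v y) t

theorem good_G {g : V → V → ℝ → ℝ} (hg : ∀ x y, Good (g x y)) (n : ℕ) :
    ∀ x y, Good (G g n x y) := by
  induction n with
  | zero => exact hg
  | succ n ih =>
    intro x y
    exact Good.sum Finset.univ fun v => (ih x v).cv (hg v y)

theorem G_comm {g : V → V → ℝ → ℝ} (hg : ∀ x y, Good (g x y)) (n : ℕ) :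
    ∀ x y, (fun t => ∑ v, cv (g x v) (G g n v y) t) = G g (n + 1) x y := by
  induction n with
  | zero => intro x y; rfl
  | succ n ih =>
    intro x y
    funext t
    calc ∑ v, cv (g x v) (G g (n + 1) v y) t
        = ∑ v, ∑ w, cv (g x v) (cv (G g n v w) (g w y)) t := by
          refine Finset.sum_congr rfl fun v _ => ?_
          exact cv_sum_right Finset.univ (fun w => (good_G hg n v w).cv (hg w y)) (hg x v) t
      _ = ∑ w, ∑ v, cv (cv (g x v) (G g n v w)) (g w y) t := by
          rw [Finset.sum_comm]
          refine Finset.sum_congr rfl fun w _ => Finset.sum_congr rfl fun v _ => ?_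
          rw [cv_assoc (hg x v) (good_G hg n v w) (hg w y)]
      _ = ∑ w, cv (G g (n + 1) x w) (g w y) t := by
          refine Finset.sum_congr rfl fun w _ => ?_
          rw [← ih x w]
          exact (cv_sum_left Finset.univ (fun v => (hg x v).cv (good_G hg n v w)) (hg w y) t).symm

/-- The interval form of the matrix convolution. -/
theorem sum_cv_interval {a b : V → ℝ → ℝ} (ha : ∀ v, Good (a v)) (hb : ∀ v, Good (b v))
    {t : ℝ} (ht : 0 ≤ t) :
    ∑ v, cv (a v) (b v) t = ∫ r in (0:ℝ)..t, ∑ v, a v (t - r) * b v r := by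
  rw [intervalIntegral.integral_finsetSum]
  · exact Finset.sum_congr rfl fun v _ => cv_interval (ha v) (hb v) ht
  · intro v _
    exact ((ha v).integrable_mul (hb v) t).intervalIntegrable

theorem G_eq {f g : V → V → ℝ → ℝ} {T : ℝ} (hg : ∀ x y, Good (g x y))
    (hfg : ∀ x y t, 0 < t → t < T → g x y t = f x y t) (n : ℕ) :
    ∀ x y t, 0 < t → t < T → G g n x y t = iterConv f n x y t := by
  induction n with
  | zero => exact hfg
  | succ n ih =>
    intro x y t ht htT
    change ∑ v, cv (G g n x v) (g v y) t = ∫ r in (0:ℝ)..t, _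
    rw [sum_cv_interval (fun v => good_G hg n x v) (fun v => hg v y) ht.le]
    refine intervalIntegral.integral_congr_Ioo_of_le ht.le fun r hr => ?_
    refine Finset.sum_congr rfl fun v _ => ?_
    rw [ih x v (t - r) (by linarith [hr.2]) (by linarith [hr.1]),
      hfg v y r hr.1 (by linarith [hr.2])]

theorem iter_bound {f : V → V → ℝ → ℝ} {T M : ℝ} (hM : 0 ≤ M)
    (hf : ∀ x y t, 0 < t → t < T → |f x y t| ≤ M) (n : ℕ) :
    ∀ x y t, 0 < t → t < T →
      |iterConv f n x y t| ≤ M * ((M * Fintype.card V * t) ^ n / n.factorial) := by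
  induction n with
  | zero =>
    intro x y t ht htT
    simpa [iterConv] using hf x y t ht htT
  | succ n ih =>
    intro x y t ht htT
    set N : ℝ := (Fintype.card V : ℝ) with hN
    have key : ∀ᵐ r : ℝ, r ∈ Set.Ioc 0 t →
        ‖∑ v : V, iterConv f n x v (t - r) * f v y r‖ ≤
          N * (M * ((M * N) ^ n / n.factorial) * M) * (t - r) ^ n := by
      filter_upwards [Measure.ae_ne volume t] with r hrt hr
      have hr' : r < t := lt_of_le_of_ne hr.2 hrt
      have : ∀ v ∈ (Finset.univ : Finset V), ‖iterConv f n x v (t - r) * f v y r‖ ≤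
          (M * ((M * N) ^ n / n.factorial) * M) * (t - r) ^ n := by
        intro v _
        rw [norm_mul, Real.norm_eq_abs, Real.norm_eq_abs]
        have h1 := ih x v (t - r) (by linarith) (by linarith [hr.1])
        have h2 := hf v y r hr.1 (by linarith)
        calc _ ≤ (M * ((M * N * (t - r)) ^ n / n.factorial)) * M :=
              mul_le_mul h1 h2 (abs_nonneg _) ((abs_nonneg _).trans h1)
          _ = _ := by rw [mul_pow (M * N)]; ring
      refine (norm_sum_le_of_le _ this).trans (le_of_eq ?_)
      simp [hN]; ring
    have hI : ∫ r in (0:ℝ)..t, (t - r) ^ n = t ^ (n + 1) / (n + 1) := by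
      rw [intervalIntegral.integral_comp_sub_left (fun r => r ^ n) t]
      simp
    have h := intervalIntegral.norm_integral_le_of_norm_le ht.le key
      (Continuous.intervalIntegrable (by fun_prop) _ _)
    rw [intervalIntegral.integral_const_mul, hI] at h
    refine h.trans (le_of_eq ?_)
    rw [Nat.factorial_succ]
    push_cast
    have := Nat.factorial_ne_zero n
    field_simp
    ring

theorem exists_bound {f : V → V → ℝ → ℝ}
    (hbound : ∀ t₀ : ℝ, 0 < t₀ → ∃ (C : ℝ) (k : ℕ),
      ∀ (x y : V) (t : ℝ), 0 < t → t < t₀ → |f x y t| ≤ C * t ^ k) {T : ℝ} (hT : 0 < T) :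
    ∃ M, 0 ≤ M ∧ ∀ x y t, 0 < t → t < T → |f x y t| ≤ M := by
  obtain ⟨C, k, h⟩ := hbound T hT
  refine ⟨|C| * T ^ k, by positivity, fun x y t ht htT => (h x y t ht htT).trans ?_⟩
  gcongr
  exact le_abs_self C

theorem iter_bound' {f : V → V → ℝ → ℝ} {T M : ℝ} (hM : 0 ≤ M)
    (hf : ∀ x y t, 0 < t → t < T → |f x y t| ≤ M) (n : ℕ) (x y : V) (t : ℝ) (ht : 0 < t)
    (htT : t < T) :
    |iterConv f n x y t| ≤ M * ((M * Fintype.card V * T) ^ n / n.factorial) := by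
  refine (iter_bound hM hf n x y t ht htT).trans ?_
  gcongr

theorem summable_bd (M c : ℝ) : Summable fun n : ℕ => M * (c ^ n / n.factorial) :=
  (Real.summable_pow_div_factorial c).mul_left M

end NeumannAux

/-- Lemma 2.3: the series `F(x,y;t) := ∑_{ℓ=1}^∞ (−1)^ℓ f^{∗ℓ}(x,y;t)` (here the index
`ℓ = n + 1` with `n : ℕ`) converges absolutely, converges uniformly on every compact
subset of `V × V × ℝ_{>0}`, and satisfies `f ∗ F = ∑_{ℓ=1}^∞ (−1)^ℓ f^{∗(ℓ+1)}`. -/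
theorem neumann_series_convergence {V : Type*} [Fintype V]
    (f : V → V → ℝ → ℝ)
    (hInt : ∀ (x y : V) (t₀ : ℝ), 0 < t₀ → IntegrableOn (f x y) (Set.Ioc 0 t₀))
    (hbound : ∀ t₀ : ℝ, 0 < t₀ → ∃ (C : ℝ) (k : ℕ),
      ∀ (x y : V) (t : ℝ), 0 < t → t < t₀ → |f x y t| ≤ C * t ^ k) :
    -- absolute convergence
    (∀ (x y : V) (t : ℝ), 0 < t →
      Summable (fun n : ℕ => |iterConv f n x y t|)) ∧
    -- uniform convergence on every compact subset of V × V × ℝ_{>0}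
    (∀ K : Set ℝ, IsCompact K → K ⊆ Set.Ioi 0 →
      TendstoUniformlyOn
        (fun (N : ℕ) (p : V × V × ℝ) =>
          ∑ n ∈ Finset.range N, (-1 : ℝ) ^ (n + 1) * iterConv f n p.1 p.2.1 p.2.2)
        (fun p : V × V × ℝ => ∑' n : ℕ, (-1 : ℝ) ^ (n + 1) * iterConv f n p.1 p.2.1 p.2.2)
        Filter.atTop (Set.univ ×ˢ Set.univ ×ˢ K)) ∧
    -- f ∗ F = ∑_{ℓ=1}^∞ (−1)^ℓ f^{∗(ℓ+1)}
    (∀ (x y : V) (t : ℝ), 0 < t →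
      graphConv f
          (fun a b s => ∑' n : ℕ, (-1 : ℝ) ^ (n + 1) * iterConv f n a b s) x y t =
        ∑' n : ℕ, (-1 : ℝ) ^ (n + 1) * iterConv f (n + 1) x y t) := by
  classical
  refine ⟨?_, ?_, ?_⟩
  · intro x y t ht
    obtain ⟨M, hM, hf⟩ := NeumannAux.exists_bound hbound (T := t + 1) (by linarith)
    exact Summable.of_nonneg_of_le (fun n => abs_nonneg _)
      (fun n => NeumannAux.iter_bound' hM hf n x y t ht (by linarith))
      (NeumannAux.summable_bd M _)
  · intro K hK hK0
    obtain ⟨R, hR⟩ := hK.bddAbove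
    have hT : 0 < |R| + 1 := by positivity
    obtain ⟨M, hM, hf⟩ := NeumannAux.exists_bound hbound hT
    refine tendstoUniformlyOn_tsum_nat
      (f := fun (n : ℕ) (p : V × V × ℝ) => (-1 : ℝ) ^ (n + 1) * iterConv f n p.1 p.2.1 p.2.2)
      (NeumannAux.summable_bd M (M * Fintype.card V * (|R| + 1))) ?_
    rintro n ⟨x, y, t⟩ hp
    have htK : t ∈ K := hp.2.2
    have h1 : t ≤ R := hR htK
    have := NeumannAux.iter_bound' hM hf n x y t (hK0 htK) (by linarith [le_abs_self R])
    simpa [norm_mul] using this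
  · intro x y t ht
    have hT : 0 < t + 1 := by linarith
    obtain ⟨M, hM, hf⟩ := NeumannAux.exists_bound hbound hT
    set T := t + 1 with hTdef
    set g : V → V → ℝ → ℝ := fun x y => (Set.Ioo 0 T).indicator (f x y) with hgdef
    have hgM : ∀ x y s, ‖g x y s‖ ≤ M := by
      intro x y s
      by_cases hs : s ∈ Set.Ioo 0 T
      · simpa [hgdef, Set.indicator_of_mem hs] using hf x y s hs.1 hs.2
      · simpa [hgdef, Set.indicator_of_notMem hs] using hM
    have hg : ∀ x y, NeumannAux.Good (g x y) := by
      intro x y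
      refine ⟨?_, ⟨M, hgM x y⟩, ?_⟩
      · exact (integrable_indicator_iff measurableSet_Ioo).2
          ((hInt x y T hT).mono_set Set.Ioo_subset_Ioc_self)
      · intro s hs
        exact Set.indicator_of_notMem (fun h => absurd h.1 (not_lt.2 hs)) _
    have hfg : ∀ x y s, 0 < s → s < T → g x y s = f x y s := fun x y s h1 h2 =>
      Set.indicator_of_mem (show s ∈ Set.Ioo 0 T from ⟨h1, h2⟩) _
    have hG := NeumannAux.G_eq hg hfg
    set c : ℝ := M * (Fintype.card V : ℝ) * T with hc
    have hGb : ∀ n a b s, 0 < s → s < T →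
        |NeumannAux.G g n a b s| ≤ M * (c ^ n / n.factorial) := by
      intro n a b s h1 h2
      rw [hG n a b s h1 h2]
      exact NeumannAux.iter_bound' hM hf n a b s h1 h2
    have hsum : ∀ a b s, 0 < s → s < T →
        Summable fun n : ℕ => (-1 : ℝ) ^ (n + 1) * NeumannAux.G g n a b s := by
      intro a b s h1 h2
      refine Summable.of_norm_bounded (NeumannAux.summable_bd M c) fun n => ?_
      simpa [norm_mul] using hGb n a b s h1 h2
    -- rewrite the left side in terms of g and G
    have hL : graphConv f
          (fun a b s => ∑' n : ℕ, (-1 : ℝ) ^ (n + 1) * iterConv f n a b s) x y t =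
        ∫ r in (0:ℝ)..t, ∑ v, g x v (t - r) *
          ∑' n : ℕ, (-1 : ℝ) ^ (n + 1) * NeumannAux.G g n v y r := by
      refine intervalIntegral.integral_congr_Ioo_of_le ht.le fun r hr => ?_
      refine Finset.sum_congr rfl fun v _ => ?_
      have hrT : r < T := by linarith [hr.2]
      rw [hfg x v (t - r) (by linarith [hr.2]) (by linarith [hr.1])]
      simp only [hG _ v y r hr.1 hrT]
    rw [hL]
    have hterm : ∀ n : ℕ, (-1 : ℝ) ^ (n + 1) * iterConv f (n + 1) x y t =
        ∫ r in (0:ℝ)..t, (-1 : ℝ) ^ (n + 1) *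
          ∑ v, g x v (t - r) * NeumannAux.G g n v y r := by
      intro n
      rw [intervalIntegral.integral_const_mul,
        ← NeumannAux.sum_cv_interval (fun v => hg x v)
          (fun v => NeumannAux.good_G hg n v y) ht.le,
        ← hG (n + 1) x y t ht (by linarith), ← NeumannAux.G_comm hg n x y]
    simp only [hterm]
    symm
    refine (intervalIntegral.hasSum_integral_of_dominated_convergence
      (fun n _ => Fintype.card V * M * (M * (c ^ n / n.factorial))) ?_ ?_ ?_ ?_ ?_).tsum_eq
    · intro n
      refine AEStronglyMeasurable.restrict ?_
      refine AEStronglyMeasurable.const_mul ?_ _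
      exact (integrable_finsetSum Finset.univ fun v _ =>
        (hg x v).integrable_mul (NeumannAux.good_G hg n v y) t).aestronglyMeasurable
    · intro n
      refine Filter.Eventually.of_forall fun r hr => ?_
      rw [Set.uIoc_of_le ht.le] at hr
      have : ∀ v ∈ (Finset.univ : Finset V),
          ‖g x v (t - r) * NeumannAux.G g n v y r‖ ≤ M * (M * (c ^ n / n.factorial)) := by
        intro v _
        rw [norm_mul]
        exact mul_le_mul (hgM _ _ _) (hGb n v y r hr.1 (by linarith [hr.2])) (norm_nonneg _) hM
      have h2 := norm_sum_le_of_le _ this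
      rw [norm_mul]
      simpa [mul_assoc] using h2
    · refine Filter.Eventually.of_forall fun r _ => ?_
      exact (NeumannAux.summable_bd M c).mul_left _
    · exact intervalIntegrable_const
    · refine Filter.Eventually.of_forall fun r hr => ?_
      rw [Set.uIoc_of_le ht.le] at hr
      have h := hasSum_sum (s := (Finset.univ : Finset V)) fun v _ =>
        ((hsum v y r hr.1 (by linarith [hr.2])).hasSum.mul_left (g x v (t - r)))
      refine h.congr_fun ?_
      intro n
      rw [Finset.mul_sum]
      exact Finset.sum_congr rfl fun v _ => by ring
end

section
/- Let V be a finite set and let f : V × V × ℝ_{>0} → ℝ be integrable in t on every interval (0,t₀], and suppose there are a constant C and an integer k ≥ 0 with |f(x,y;t)| ≤ C t^k for all x, y ∈ V and 0 < t < t₀. Then ∑_{ℓ=1}^∞ |f^{∗ℓ}(x,y;t)| = O(t^k) as t → 0, uniformly in x, y ∈ V. -/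
open MeasureTheory

lemma iterConv_bound_s4 {V : Type*} [Fintype V] (f : V → V → ℝ → ℝ) (A δ : ℝ) (k : ℕ) (hA : 0 ≤ A)
    (hδ1 : δ ≤ 1) (hδ : Fintype.card V * A * δ ≤ 1 / 2)
    (hf : ∀ (x y : V) (t : ℝ), 0 < t → t < δ → |f x y t| ≤ A * t ^ k) (n : ℕ) :
    ∀ (x y : V) (t : ℝ), 0 < t → t < δ → |iterConv f n x y t| ≤ A * t ^ k * (1 / 2) ^ n := by
  induction n with
  | zero => intro x y t h0 h1; simpa [iterConv] using hf x y t h0 h1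
  | succ n ih =>
    intro x y t h0 h1
    have key : ‖∫ r in (0:ℝ)..t, ∑ v : V, iterConv f n x v (t - r) * f v y r‖ ≤
        (Fintype.card V * (A * t ^ k * (1 / 2) ^ n * A)) * |t - 0| := by
      apply intervalIntegral.norm_integral_le_of_norm_le_const_ae
      have hne : ∀ᵐ r : ℝ, r ≠ t := by simp [ae_iff]
      filter_upwards [hne] with r hr hmem
      rw [Set.uIoc_of_le h0.le] at hmem
      have hrt : r < t := lt_of_le_of_ne hmem.2 hr
      refine (norm_sum_le _ _).trans ?_
      refine (Finset.sum_le_card_nsmul _ _ (A * t ^ k * (1 / 2) ^ n * A) ?_).trans ?_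
      · intro v _
        rw [norm_mul, Real.norm_eq_abs, Real.norm_eq_abs]
        have a1 := ih x v (t - r) (by linarith) (by linarith [hmem.1])
        have a2 := hf v y r hmem.1 (by linarith)
        have b1 : (t - r) ^ k ≤ t ^ k :=
          pow_le_pow_left₀ (by linarith) (by linarith [hmem.1]) k
        have b2 : r ^ k ≤ 1 := pow_le_one₀ hmem.1.le (by linarith)
        apply mul_le_mul (a1.trans _) (a2.trans _) (abs_nonneg _) (by positivity)
        · gcongr
        · exact mul_le_of_le_one_right hA b2
      · simp
    change ‖∫ r in (0:ℝ)..t, ∑ v : V, iterConv f n x v (t - r) * f v y r‖ ≤ _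
    refine key.trans ?_
    rw [sub_zero, abs_of_pos h0]
    have h2 : Fintype.card V * A * t ≤ 1 / 2 := le_trans (by gcongr) hδ
    have h3 : 0 ≤ A * t ^ k * (1 / 2) ^ n := by positivity
    calc _ = (A * t ^ k * (1 / 2) ^ n) * (Fintype.card V * A * t) := by ring
      _ ≤ (A * t ^ k * (1 / 2) ^ n) * (1 / 2) := by gcongr
      _ = _ := by ring

/-- `∑_{ℓ=1}^∞ |f^{∗ℓ}(x,y;t)| = O(t^k)` as `t → 0`, uniformly in `x, y ∈ V`. -/
theorem sum_iterConv_isBigO {V : Type*} [Fintype V]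
    (f : V → V → ℝ → ℝ) (t₀ : ℝ) (ht₀ : 0 < t₀)
    (hInt : ∀ x y : V, IntegrableOn (f x y) (Set.Ioc 0 t₀))
    (C : ℝ) (k : ℕ)
    (hf : ∀ (x y : V) (t : ℝ), 0 < t → t < t₀ → |f x y t| ≤ C * t ^ k) :
    ∃ (C' : ℝ) (δ : ℝ), 0 < δ ∧
      ∀ (x y : V) (t : ℝ), 0 < t → t < δ →
        ∑' n : ℕ, |iterConv f n x y t| ≤ C' * t ^ k := by
  have hB : (0:ℝ) < 2 * (Fintype.card V * |C| + 1) := by positivity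
  refine ⟨2 * |C|, min t₀ (min 1 (1 / (2 * (Fintype.card V * |C| + 1)))), by positivity, ?_⟩
  intro x y t h0 h1
  have hb := fun n => iterConv_bound_s4 f |C| (min t₀ (min 1 (1 / (2 * (Fintype.card V * |C| + 1))))) k
    (abs_nonneg C) ((min_le_right _ _).trans (min_le_left _ _))
    (by
      refine (mul_le_mul_of_nonneg_left
        ((min_le_right _ _).trans (min_le_right _ _)) (by positivity)).trans ?_
      rw [mul_one_div, div_le_iff₀ hB]
      linarith)
    (fun x y s hs0 hs1 => (hf x y s hs0 (hs1.trans_le (min_le_left _ _))).trans (by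
      gcongr
      exact le_abs_self C)) n x y t h0 h1
  have hs : Summable fun n : ℕ => |C| * t ^ k * (1 / 2 : ℝ) ^ n :=
    summable_geometric_two.mul_left _
  refine ((Summable.of_nonneg_of_le (fun _ => abs_nonneg _) hb hs).tsum_le_tsum hb hs).trans ?_
  rw [tsum_mul_left, tsum_geometric_two]
  linarith
end

section
/- Let H be a parametrix for the heat operator on a finite weighted graph G, and let f : V × V × ℝ_{>0} → ℝ be continuous in t and bounded for all vertex pairs. Then for all x, y ∈ V and all t > 0, L_x(H ∗ f)(x,y;t) = f(x,y;t) + ((L_x H) ∗ f)(x,y;t). -/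
open MeasureTheory

/-- The weighted graph Laplacian acting in the first vertex variable:
`Δ_x F(x,y;t) = ∑_{v} (F(x,y;t) − F(v,y;t)) w(x,v)`. -/
def graphLap {V : Type*} [Fintype V] (w : V → V → ℝ) (F : V → V → ℝ → ℝ) :
    V → V → ℝ → ℝ :=
  fun x y t => ∑ v : V, (F x y t - F v y t) * w x v

/-- The heat operator acting in the first vertex variable: `L_x F = Δ_x F + ∂F/∂t`. -/
noncomputable def heatOp {V : Type*} [Fintype V] (w : V → V → ℝ) (F : V → V → ℝ → ℝ) :
    V → V → ℝ → ℝ :=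
  fun x y t => graphLap w F x y t + deriv (fun s => F x y s) t

theorem aux_int {φ : ℝ → ℝ} {M : ℝ} (hc : ContinuousOn φ (Set.Ioi 0))
    (hb : ∀ r, 0 < r → |φ r| ≤ M) {a b : ℝ} (ha : 0 ≤ a) (hb0 : 0 ≤ b) :
    IntervalIntegrable φ volume a b := by
  have key : ∀ c : ℝ, 0 ≤ c → IntervalIntegrable φ volume 0 c := by
    intro c h0c
    rw [intervalIntegrable_iff_integrableOn_Ioc_of_le h0c]
    have hm : AEStronglyMeasurable φ (volume.restrict (Set.Ioc 0 c)) :=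
      (hc.mono (fun r hr => hr.1)).aestronglyMeasurable measurableSet_Ioc
    refine Integrable.of_bound hm M ?_
    · filter_upwards [ae_restrict_mem measurableSet_Ioc] with r hr
      exact hb r hr.1
  exact (key a ha).symm.trans (key b hb0)

theorem aux_core {p k φ : ℝ → ℝ} {M : ℝ} (hk : Continuous k)
    (hp : ∀ s, HasDerivAt p (k s) s) (hc : ContinuousOn φ (Set.Ioi 0))
    (hb : ∀ r, 0 < r → |φ r| ≤ M) {t : ℝ} (ht : 0 < t) :
    HasDerivAt (fun s => ∫ r in (0:ℝ)..s, p (s - r) * φ r)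
      (p 0 * φ t + ∫ r in (0:ℝ)..t, k (t - r) * φ r) t := by
  have hpc : Continuous p := continuous_iff_continuousAt.2 fun s => (hp s).continuousAt
  have hqInt : ∀ (q : ℝ → ℝ) (s a b : ℝ), Continuous q → 0 ≤ a → 0 ≤ b →
      IntervalIntegrable (fun r => q (s - r) * φ r) volume a b := by
    intro q s a b hq ha hb0
    exact (aux_int hc hb ha hb0).continuousOn_mul (by fun_prop)
  have hM : 0 ≤ M := (abs_nonneg _).trans (hb t ht)
  -- fixed upper limit
  have h1 : HasDerivAt (fun s => ∫ r in (0:ℝ)..t, p (s - r) * φ r)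
      (∫ r in (0:ℝ)..t, k (t - r) * φ r) t := by
    obtain ⟨C, hC⟩ := (isCompact_Icc (a := -1 - t) (b := t + 1)).exists_bound_of_continuousOn
      hk.continuousOn
    refine (intervalIntegral.hasDerivAt_integral_of_dominated_loc_of_deriv_le
      (F := fun s r => p (s - r) * φ r) (F' := fun s r => k (s - r) * φ r)
      (s := Metric.ball t 1) (bound := fun _ => C * M) (Metric.ball_mem_nhds t one_pos)
      ?_ ?_ ?_ ?_ ?_ ?_).2
    · exact Filter.Eventually.of_forall fun s =>
        (IntervalIntegrable.def' (hqInt p s 0 t hpc le_rfl ht.le)).aestronglyMeasurable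
    · exact hqInt p t 0 t hpc le_rfl ht.le
    · exact (IntervalIntegrable.def' (hqInt k t 0 t hk le_rfl ht.le)).aestronglyMeasurable
    · refine Filter.Eventually.of_forall fun r hr s hs => ?_
      rw [Set.uIoc_of_le ht.le] at hr
      rw [Metric.mem_ball, Real.dist_eq, abs_lt] at hs
      rw [norm_mul]
      have h2 := hC (s - r) ⟨by linarith [hr.2], by linarith [hr.1]⟩
      exact mul_le_mul h2 (hb r hr.1) (norm_nonneg _) ((norm_nonneg _).trans h2)
    · exact intervalIntegrable_const
    · refine Filter.Eventually.of_forall fun r hr s hs => ?_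
      exact ((hp (s - r)).comp_sub_const s r).mul_const (φ r)
  -- moving upper limit
  have h2 : HasDerivAt (fun s => ∫ r in t..s, p (s - r) * φ r) (p 0 * φ t) t := by
    rw [hasDerivAt_iff_isLittleO]
    rw [Asymptotics.isLittleO_iff]
    intro ε hε
    have hcont : ContinuousAt (fun z : ℝ × ℝ => p (z.1 - z.2) * φ z.2) (t, t) := by
      have e1 : ContinuousAt φ t := hc.continuousAt (Ioi_mem_nhds ht)
      have e2 : ContinuousAt (fun z : ℝ × ℝ => φ z.2) (t, t) :=
        ContinuousAt.comp (f := Prod.snd) (x := (t, t)) e1 continuousAt_snd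
      exact ContinuousAt.mul (by fun_prop) e2
    obtain ⟨δ, hδ, hd⟩ := Metric.continuousAt_iff.1 hcont ε hε
    filter_upwards [Metric.ball_mem_nhds t hδ, Ioi_mem_nhds ht] with s hs hs0
    have hs0' : (0:ℝ) < s := hs0
    have e : (∫ r in t..s, p (s - r) * φ r) - (∫ r in t..t, p (t - r) * φ r)
        - (s - t) • (p 0 * φ t) = ∫ r in t..s, (p (s - r) * φ r - p 0 * φ t) := by
      rw [intervalIntegral.integral_sub (hqInt p s t s hpc ht.le hs0'.le)
        intervalIntegrable_const]
      simp only [intervalIntegral.integral_same, intervalIntegral.integral_const, sub_zero]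
    rw [e]
    refine intervalIntegral.norm_integral_le_of_norm_le_const fun r hr => ?_
    have hrd : dist r t < δ := by
      refine lt_of_le_of_lt ?_ (Metric.mem_ball.1 hs)
      rw [Real.dist_eq, Real.dist_eq]
      exact Set.abs_sub_left_of_mem_uIcc (Set.uIoc_subset_uIcc hr)
    have := @hd (s, r) (by rw [Prod.dist_eq]; exact max_lt hs hrd)
    simp only [sub_self] at this
    exact (le_of_lt (by simpa [Real.dist_eq] using this))
  rw [add_comm]
  refine (h1.add h2).congr_of_eventuallyEq ?_
  filter_upwards [Ioi_mem_nhds ht] with s hs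
  have hs' : (0:ℝ) < s := hs
  exact (intervalIntegral.integral_add_adjacent_intervals (hqInt p s 0 t hpc le_rfl ht.le)
    (hqInt p s t s hpc ht.le hs'.le)).symm

theorem aux_conv {h k φ : ℝ → ℝ} {M : ℝ} (hh : ContinuousOn h (Set.Ici 0))
    (hd : ∀ s, 0 < s → HasDerivAt h (k s) s) (hk : ContinuousOn k (Set.Ici 0))
    (hc : ContinuousOn φ (Set.Ioi 0))
    (hb : ∀ r, 0 < r → |φ r| ≤ M) {t : ℝ} (ht : 0 < t) :
    HasDerivAt (fun s => ∫ r in (0:ℝ)..s, h (s - r) * φ r)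
      (h 0 * φ t + ∫ r in (0:ℝ)..t, k (t - r) * φ r) t := by
  set kk : ℝ → ℝ := fun s => k (max s 0) with hkk
  have hkkc : Continuous kk :=
    hk.comp_continuous (by fun_prop) (fun s => le_max_right s 0)
  set p : ℝ → ℝ := fun s => h 0 + ∫ u in (0:ℝ)..s, kk u with hpdef
  have hp : ∀ s, HasDerivAt p (kk s) s := fun s =>
    (intervalIntegral.integral_hasDerivAt_right (hkkc.intervalIntegrable _ _)
      (hkkc.stronglyMeasurableAtFilter _ _) hkkc.continuousAt).const_add _
  have hph : ∀ s, 0 ≤ s → p s = h s := by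
    intro s hs
    have := intervalIntegral.integral_eq_sub_of_hasDerivAt_of_le hs
      (hh.mono (fun u hu => hu.1)) (f' := kk)
      (fun u hu => by simpa [hkk, max_eq_left hu.1.le] using hd u hu.1)
      (hkkc.intervalIntegrable _ _)
    simp only [hpdef, this]
    ring
  have main := aux_core hkkc hp hc hb ht
  have e1 : (∫ r in (0:ℝ)..t, kk (t - r) * φ r) = ∫ r in (0:ℝ)..t, k (t - r) * φ r := by
    refine intervalIntegral.integral_congr fun r hr => ?_
    rw [Set.uIcc_of_le ht.le] at hr
    simp only [hkk, max_eq_left (sub_nonneg.2 hr.2)]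
  rw [hph 0 le_rfl, e1] at main
  refine main.congr_of_eventuallyEq ?_
  filter_upwards [Ioi_mem_nhds ht] with s hs
  have hs' : (0:ℝ) < s := hs
  refine intervalIntegral.integral_congr fun r hr => ?_
  rw [Set.uIcc_of_le hs'.le] at hr
  simp only [hph _ (sub_nonneg.2 hr.2)]

theorem aux_conv_int {h φ : ℝ → ℝ} {M : ℝ} (hh : ContinuousOn h (Set.Ici 0))
    (hc : ContinuousOn φ (Set.Ioi 0))
    (hb : ∀ r, 0 < r → |φ r| ≤ M) {t : ℝ} (ht : 0 ≤ t) :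
    IntervalIntegrable (fun r => h (t - r) * φ r) volume 0 t := by
  refine (aux_int hc hb le_rfl ht).continuousOn_mul ?_
  refine hh.comp (by fun_prop) fun r hr => ?_
  rw [Set.uIcc_of_le ht] at hr
  exact sub_nonneg.2 hr.2

/-- Lemma 3.1: if `H` is a parametrix for the heat operator on the finite weighted graph
`(V, w)` and `f` is continuous in `t` and bounded, then
`L_x (H ∗ f) = f + (L_x H) ∗ f` for all vertices and all `t > 0`. -/
theorem heatOp_conv_parametrix {V : Type*} [Fintype V] [DecidableEq V]
    (w : V → V → ℝ) (hw_symm : ∀ x y : V, w x y = w y x)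
    (hw_nonneg : ∀ x y : V, 0 ≤ w x y)
    (H : V → V → ℝ → ℝ)
    -- H is continuous on V × V × [0,∞)
    (hHcont : ∀ x y : V, ContinuousOn (H x y) (Set.Ici 0))
    -- H is smooth in t on (0,∞)
    (hHsmooth : ∀ x y : V, ContDiffOn ℝ (⊤ : ℕ∞) (H x y) (Set.Ioi 0))
    -- the Dirac property at t = 0
    (hH0 : ∀ x y : V, H x y 0 = if x = y then 1 else 0)
    -- L_x H extends to a continuous function on [0,∞)
    (hLext : ∀ x y : V, ∃ g : ℝ → ℝ, ContinuousOn g (Set.Ici 0) ∧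
      Set.EqOn g (fun t => heatOp w H x y t) (Set.Ioi 0))
    (f : V → V → ℝ → ℝ)
    (hfcont : ∀ x y : V, ContinuousOn (f x y) (Set.Ioi 0))
    (hfbdd : ∃ M : ℝ, ∀ (x y : V) (t : ℝ), 0 < t → |f x y t| ≤ M)
    (x y : V) (t : ℝ) (ht : 0 < t) :
    heatOp w (graphConv H f) x y t =
      f x y t + graphConv (heatOp w H) f x y t := by
  obtain ⟨M, hM⟩ := hfbdd
  choose g hgc hge using hLext
  have hfy : ∀ v r, 0 < r → |f v y r| ≤ M := fun v r hr => hM v y r hr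
  have hlapc : ∀ a v, ContinuousOn (graphLap w H a v) (Set.Ici 0) := by
    intro a v
    unfold graphLap
    exact continuousOn_finsetSum _ fun u _ =>
      ((hHcont a v).sub (hHcont u v)).mul continuousOn_const
  -- the continuous extension of the time derivative
  have hder : ∀ v s, 0 < s → HasDerivAt (H x v) (g x v s - graphLap w H x v s) s := by
    intro v s hs
    have h1 : DifferentiableAt ℝ (H x v) s :=
      ((hHsmooth x v).differentiableOn (by simp)).differentiableAt (Ioi_mem_nhds hs)
    have h2 := hge x v hs
    have h3 : g x v s - graphLap w H x v s = deriv (H x v) s := by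
      rw [h2]; simp [heatOp]
    rw [h3]
    exact h1.hasDerivAt
  have hI : ∀ a v s, 0 ≤ s →
      IntervalIntegrable (fun r => H a v (s - r) * f v y r) volume 0 s := fun a v s hs =>
    aux_conv_int (hHcont a v) (hfcont v y) (hfy v) hs
  have hconv : ∀ a s, 0 ≤ s →
      graphConv H f a y s = ∑ v, ∫ r in (0:ℝ)..s, H a v (s - r) * f v y r := by
    intro a s hs
    unfold graphConv
    exact intervalIntegral.integral_finsetSum fun v _ => hI a v s hs
  have hderiv : HasDerivAt (fun s => graphConv H f x y s)
      (∑ v, (H x v 0 * f v y t +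
        ∫ r in (0:ℝ)..t, (g x v (t - r) - graphLap w H x v (t - r)) * f v y r)) t := by
    have := HasDerivAt.fun_sum (u := Finset.univ) fun v _ =>
      aux_conv (k := fun s => g x v s - graphLap w H x v s) (hHcont x v) (hder v)
        ((hgc x v).sub (hlapc x v)) (hfcont v y) (hfy v) ht
    refine this.congr_of_eventuallyEq ?_
    filter_upwards [Ioi_mem_nhds ht] with s hs
    exact hconv x s (le_of_lt hs)
  have hLI : ∀ v, IntervalIntegrable (fun r => graphLap w H x v (t - r) * f v y r) volume 0 t :=
    fun v => aux_conv_int (hlapc x v) (hfcont v y) (hfy v) ht.le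
  have hgI : ∀ v, IntervalIntegrable (fun r => g x v (t - r) * f v y r) volume 0 t :=
    fun v => aux_conv_int (hgc x v) (hfcont v y) (hfy v) ht.le
  have hlap : graphLap w (graphConv H f) x y t =
      ∑ v, ∫ r in (0:ℝ)..t, graphLap w H x v (t - r) * f v y r := by
    have e : ∀ v, (∫ r in (0:ℝ)..t, graphLap w H x v (t - r) * f v y r) =
        ∑ u, ((∫ r in (0:ℝ)..t, H x v (t - r) * f v y r) -
          ∫ r in (0:ℝ)..t, H u v (t - r) * f v y r) * w x u := by
      intro v
      have e0 : ∀ r, graphLap w H x v (t - r) * f v y r =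
          ∑ u, (H x v (t - r) * f v y r - H u v (t - r) * f v y r) * w x u := by
        intro r
        unfold graphLap
        rw [Finset.sum_mul]
        exact Finset.sum_congr rfl fun u _ => by ring
      simp only [e0]
      rw [intervalIntegral.integral_finsetSum fun u _ =>
        ((hI x v t ht.le).sub (hI u v t ht.le)).mul_const _]
      refine Finset.sum_congr rfl fun u _ => ?_
      rw [intervalIntegral.integral_mul_const,
        intervalIntegral.integral_sub (hI x v t ht.le) (hI u v t ht.le)]
    simp only [e]
    rw [Finset.sum_comm]
    unfold graphLap
    refine Finset.sum_congr rfl fun u _ => ?_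
    rw [hconv x t ht.le, hconv u t ht.le, ← Finset.sum_sub_distrib, Finset.sum_mul]
  have hR : graphConv (heatOp w H) f x y t =
      ∑ v, ∫ r in (0:ℝ)..t, g x v (t - r) * f v y r := by
    rw [← intervalIntegral.integral_finsetSum fun v _ => hgI v]
    unfold graphConv
    refine intervalIntegral.integral_congr_ae ?_
    have hne : ∀ᵐ r : ℝ, r ≠ t := by simp [ae_iff]
    filter_upwards [hne] with r hrt hr
    rw [Set.uIoc_of_le ht.le] at hr
    refine Finset.sum_congr rfl fun v _ => ?_
    have : (0:ℝ) < t - r := sub_pos.2 (lt_of_le_of_ne hr.2 hrt)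
    rw [hge x v this]
  have hsplit : ∀ v, (∫ r in (0:ℝ)..t, (g x v (t - r) - graphLap w H x v (t - r)) * f v y r) =
      (∫ r in (0:ℝ)..t, g x v (t - r) * f v y r) -
        ∫ r in (0:ℝ)..t, graphLap w H x v (t - r) * f v y r := by
    intro v
    rw [← intervalIntegral.integral_sub (hgI v) (hLI v)]
    simp only [sub_mul]
  have hdirac : ∑ v, H x v 0 * f v y t = f x y t := by
    simp [hH0]
  unfold heatOp at hR ⊢
  rw [hderiv.deriv, hlap, hR, Finset.sum_add_distrib, hdirac]
  simp only [hsplit, Finset.sum_sub_distrib]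
  ring
end

section
/- Let H be a parametrix of order k ≥ 0 for the heat operator on a finite weighted graph G, and define F(x,y;t) = ∑_{ℓ=1}^∞ (−1)^ℓ (L_x H)^{∗ℓ}(x,y;t). Then: (1) the series defining F converges absolutely and uniformly on every compact subset of V × V × ℝ_{≥0}; (2) the function H_G := H + H ∗ F satisfies L_x H_G(x,y;t) = 0 for all x, y ∈ V and t > 0 and lim_{t→0} H_G(x,y;t) = 1 if x = y and 0 otherwise, i.e., H_G is the heat kernel on G; (3) (H ∗ F)(x,y;t) = O(t^{k+1}) as t → 0. -/
open MeasureTheory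

namespace ParamAux

lemma triangle_swap (φ : ℝ → ℝ → ℝ) (hφ : Continuous φ.uncurry) (t : ℝ) (ht : 0 ≤ t) :
    ∫ r in (0:ℝ)..t, ∫ s in r..t, φ r s = ∫ s in (0:ℝ)..t, ∫ r in (0:ℝ)..s, φ r s := by
  let S : Set (ℝ × ℝ) := {p | p.1 ≤ p.2}
  have hS : MeasurableSet S := measurableSet_le measurable_fst measurable_snd
  let G : ℝ → ℝ → ℝ := fun r s => S.indicator φ.uncurry (r, s)
  have hG : IntegrableOn G.uncurry (Set.uIoc 0 t ×ˢ Set.uIoc 0 t) := by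
    have h1 : IntegrableOn φ.uncurry (Set.uIoc 0 t ×ˢ Set.uIoc 0 t) := by
      have h2 : IntegrableOn φ.uncurry (Set.Icc 0 t ×ˢ Set.Icc 0 t) :=
        hφ.continuousOn.integrableOn_compact (isCompact_Icc.prod isCompact_Icc)
      refine h2.mono_set ?_
      rw [Set.uIoc_of_le ht]
      exact Set.prod_mono Set.Ioc_subset_Icc_self Set.Ioc_subset_Icc_self
    have : G.uncurry = S.indicator φ.uncurry := by
      ext ⟨r, s⟩; rfl
    rw [this]
    exact h1.indicator hS
  have key := intervalIntegral_intervalIntegral_swap hG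
  have e1 : ∫ r in (0:ℝ)..t, ∫ s in (0:ℝ)..t, G r s
      = ∫ r in (0:ℝ)..t, ∫ s in r..t, φ r s := by
    refine intervalIntegral.integral_congr ?_
    intro r hr
    rw [Set.uIcc_of_le ht] at hr
    have c1 : Set.EqOn (G r) (fun _ => 0) (Set.Ioo 0 r) := by
      intro s hs
      have : (r, s) ∉ S := by simp [S, hs.2]
      simp [G, this]
    have c2 : Set.EqOn (G r) (φ r) (Set.Ioo r t) := by
      intro s hs
      have : (r, s) ∈ S := by simp [S, hs.1.le]
      simp [G, this]
    have hφr : Continuous (φ r) := by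
      exact hφ.comp (Continuous.prodMk_right r)
    have i1 : IntervalIntegrable (G r) volume 0 r :=
      (intervalIntegrable_const (c := (0:ℝ))).congr_uIoo
        (by rw [Set.uIoo_of_le hr.1]; exact c1.symm)
    have i2 : IntervalIntegrable (G r) volume r t :=
      (hφr.intervalIntegrable r t).congr_uIoo
        (by rw [Set.uIoo_of_le hr.2]; exact c2.symm)
    have : ∫ s in (0:ℝ)..t, G r s = ∫ s in r..t, φ r s := by
      rw [← intervalIntegral.integral_add_adjacent_intervals i1 i2,
        intervalIntegral.integral_congr_Ioo_of_le hr.1 c1,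
        intervalIntegral.integral_congr_Ioo_of_le hr.2 c2]
      simp
    exact this
  have e2 : ∫ s in (0:ℝ)..t, ∫ r in (0:ℝ)..t, G r s
      = ∫ s in (0:ℝ)..t, ∫ r in (0:ℝ)..s, φ r s := by
    refine intervalIntegral.integral_congr ?_
    intro s hs
    rw [Set.uIcc_of_le ht] at hs
    have : ∫ r in (0:ℝ)..t, G r s = ∫ r in (0:ℝ)..s, φ r s := by
      rw [← intervalIntegral.integral_indicator hs]
      rfl
    exact this
  rw [← e1, key, e2]

lemma scalar_assoc (a b c : ℝ → ℝ) (ha : Continuous a) (hb : Continuous b) (hc : Continuous c)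
    (t : ℝ) (ht : 0 ≤ t) :
    ∫ r in (0:ℝ)..t, (∫ s in (0:ℝ)..(t - r), a (t - r - s) * b s) * c r
      = ∫ s in (0:ℝ)..t, a (t - s) * ∫ r in (0:ℝ)..s, b (s - r) * c r := by
  have := triangle_swap (fun r s => a (t - s) * (b (s - r) * c r)) (by fun_prop) t ht
  simp_rw [intervalIntegral.integral_const_mul] at this
  rw [← this]
  refine intervalIntegral.integral_congr fun r _ => ?_
  have h := intervalIntegral.integral_comp_sub_right (a := r) (b := t)
    (fun s => a (t - r - s) * b s) r
  simp only [sub_self] at h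
  beta_reduce
  rw [← h, ← intervalIntegral.integral_mul_const]
  refine intervalIntegral.integral_congr fun s _ => ?_
  beta_reduce
  rw [show t - r - (s - r) = t - s by ring]
  ring

variable {V : Type*} [Fintype V]

lemma conv_cont {A B : V → V → ℝ → ℝ} (hA : ∀ x y, Continuous (A x y))
    (hB : ∀ x y, Continuous (B x y)) (x y : V) : Continuous (graphConv A B x y) := by
  unfold graphConv
  refine intervalIntegral.continuous_parametric_intervalIntegral_of_continuous
    (f := fun t r => ∑ v : V, A x v (t - r) * B v y r) ?_ continuous_id
  unfold Function.uncurry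
  fun_prop

lemma conv_eq_sum {A B : V → V → ℝ → ℝ} (hA : ∀ x y, Continuous (A x y))
    (hB : ∀ x y, Continuous (B x y)) (x y : V) (t : ℝ) :
    graphConv A B x y t = ∑ v : V, ∫ r in (0:ℝ)..t, A x v (t - r) * B v y r := by
  unfold graphConv
  refine intervalIntegral.integral_finsetSum fun v _ => ?_
  exact Continuous.intervalIntegrable (by fun_prop) _ _

lemma conv_assoc {A B C : V → V → ℝ → ℝ} (hA : ∀ x y, Continuous (A x y))
    (hB : ∀ x y, Continuous (B x y)) (hC : ∀ x y, Continuous (C x y)) (x y : V) (t : ℝ)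
    (ht : 0 ≤ t) :
    graphConv (graphConv A B) C x y t = graphConv A (graphConv B C) x y t := by
  have pc : ∀ {a b : ℝ → ℝ}, Continuous a → Continuous b →
      Continuous fun t => ∫ s in (0:ℝ)..t, a (t - s) * b s := by
    intro a b ha hb
    refine intervalIntegral.continuous_parametric_intervalIntegral_of_continuous
      (f := fun t r => a (t - r) * b r) ?_ continuous_id
    unfold Function.uncurry
    fun_prop
  rw [conv_eq_sum (conv_cont hA hB) hC, conv_eq_sum hA (conv_cont hB hC)]
  simp_rw [conv_eq_sum hA hB, conv_eq_sum hB hC, Finset.sum_mul, Finset.mul_sum]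
  have e1 : ∀ v, ∫ r in (0:ℝ)..t, ∑ u : V, (∫ s in (0:ℝ)..(t - r), A x u (t - r - s) * B u v s)
        * C v y r
      = ∑ u : V, ∫ s in (0:ℝ)..t, A x u (t - s) * ∫ r in (0:ℝ)..s, B u v (s - r) * C v y r := by
    intro v
    rw [intervalIntegral.integral_finsetSum]
    · refine Finset.sum_congr rfl fun u _ => ?_
      exact scalar_assoc _ _ _ (hA x u) (hB u v) (hC v y) t ht
    · intro u _
      have := pc (hA x u) (hB u v)
      exact Continuous.intervalIntegrable
        ((this.comp (continuous_const.sub continuous_id)).mul (hC v y)) _ _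
  have e2 : ∀ u, ∫ s in (0:ℝ)..t, ∑ v : V, A x u (t - s) * ∫ r in (0:ℝ)..s, B u v (s - r) * C v y r
      = ∑ v : V, ∫ s in (0:ℝ)..t, A x u (t - s) * ∫ r in (0:ℝ)..s, B u v (s - r) * C v y r := by
    intro u
    rw [intervalIntegral.integral_finsetSum]
    intro v _
    have := pc (hB u v) (hC v y)
    have h2 := hA x u
    exact Continuous.intervalIntegrable
        ((h2.comp (continuous_const.sub continuous_id)).mul this) _ _
  simp_rw [e1, e2]
  exact Finset.sum_comm

lemma conv_congr {A A' B B' : V → V → ℝ → ℝ} (hA : ∀ x y t, 0 < t → A x y t = A' x y t)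
    (hB : ∀ x y t, 0 < t → B x y t = B' x y t) (x y : V) (t : ℝ) (ht : 0 ≤ t) :
    graphConv A B x y t = graphConv A' B' x y t := by
  unfold graphConv
  refine intervalIntegral.integral_congr_Ioo_of_le ht fun r hr => ?_
  refine Finset.sum_congr rfl fun v _ => ?_
  rw [hA _ _ _ (sub_pos.2 hr.2), hB _ _ _ hr.1]

lemma iter_cont {g : V → V → ℝ → ℝ} (hg : ∀ x y, Continuous (g x y)) (n : ℕ) :
    ∀ x y, Continuous (iterConv g n x y) := by
  induction n with
  | zero => exact hg
  | succ n ih => exact conv_cont ih hg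

lemma iter_congr {f g : V → V → ℝ → ℝ} (h : ∀ x y t, 0 < t → f x y t = g x y t) (n : ℕ) :
    ∀ x y t, 0 < t → iterConv f n x y t = iterConv g n x y t := by
  induction n with
  | zero => exact h
  | succ n ih => intro x y t ht; exact conv_congr ih h x y t ht.le

lemma iter_comm {g : V → V → ℝ → ℝ} (hg : ∀ x y, Continuous (g x y)) (n : ℕ) :
    ∀ x y t, 0 ≤ t → graphConv g (iterConv g n) x y t = iterConv g (n + 1) x y t := by
  induction n with
  | zero => intro x y t _; rfl
  | succ n ih =>
    intro x y t ht
    change graphConv g (graphConv (iterConv g n) g) x y t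
      = graphConv (iterConv g (n+1)) g x y t
    rw [← conv_assoc hg (iter_cont hg n) hg x y t ht]
    exact conv_congr (fun x y t ht => ih x y t ht.le) (fun _ _ _ _ => rfl) x y t ht

lemma exists_bound {g : V → V → ℝ → ℝ} (hg : ∀ x y, Continuous (g x y)) (T : ℝ) :
    ∃ M, 0 ≤ M ∧ ∀ x y, ∀ t ∈ Set.Icc 0 T, |g x y t| ≤ M := by
  have : ∀ x y, ∃ M, ∀ t ∈ Set.Icc 0 T, |g x y t| ≤ M := fun x y => by
    simpa using isCompact_Icc.exists_bound_of_continuousOn (hg x y).continuousOn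
  choose M hM using this
  refine ⟨∑ x, ∑ y, |M x y|, by positivity, fun x y t ht => ?_⟩
  calc |g x y t| ≤ M x y := hM x y t ht
    _ ≤ |M x y| := le_abs_self _
    _ ≤ ∑ y, |M x y| := Finset.single_le_sum (f := fun y => |M x y|)
        (fun _ _ => abs_nonneg _) (Finset.mem_univ y)
    _ ≤ _ := Finset.single_le_sum (f := fun x => ∑ y, |M x y|)
        (fun _ _ => by positivity) (Finset.mem_univ x)

lemma iter_bound {g : V → V → ℝ → ℝ} (T M : ℝ) (hM0 : 0 ≤ M)
    (hM : ∀ x y, ∀ t ∈ Set.Icc 0 T, |g x y t| ≤ M) (n : ℕ) :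
    ∀ x y, ∀ t ∈ Set.Icc 0 T,
      |iterConv g n x y t| ≤ M * ((Fintype.card V * M) ^ n * t ^ n / n.factorial) := by
  induction n with
  | zero => intro x y t ht; simpa [iterConv] using hM x y t ht
  | succ n ih =>
    intro x y t ht
    change |∫ r in (0:ℝ)..t, ∑ v : V, iterConv g n x v (t - r) * g v y r| ≤ _
    have hle : ∀ r ∈ Set.Ioc 0 t, ‖∑ v : V, iterConv g n x v (t - r) * g v y r‖
        ≤ M * ((Fintype.card V * M) ^ (n+1) * (t - r) ^ n / n.factorial) := by
      intro r hr
      refine (norm_sum_le _ _).trans ?_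
      have : ∀ v ∈ Finset.univ, ‖iterConv g n x v (t - r) * g v y r‖
          ≤ M * ((Fintype.card V * M) ^ n * (t - r) ^ n / n.factorial) * M := by
        intro v _
        rw [norm_mul]
        have h1 := ih x v (t - r) ⟨by linarith [hr.2], by linarith [hr.1, ht.2]⟩
        have h2 := hM v y r ⟨hr.1.le, hr.2.trans ht.2⟩
        exact mul_le_mul h1 h2 (norm_nonneg _) ((abs_nonneg _).trans h1)
      refine (Finset.sum_le_sum this).trans (le_of_eq ?_)
      rw [Finset.sum_const, Finset.card_univ, nsmul_eq_mul]
      ring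
    have := intervalIntegral.norm_integral_le_of_norm_le (μ := volume) ht.1
      (Filter.Eventually.of_forall fun r hr => hle r hr)
      (Continuous.intervalIntegrable (by fun_prop) _ _)
    refine this.trans (le_of_eq ?_)
    have hi : ∫ r in (0:ℝ)..t, (t - r) ^ n = t ^ (n+1) / (n+1) := by
      rw [intervalIntegral.integral_comp_sub_left (fun r => r ^ n) t]
      simp
    calc ∫ r in (0:ℝ)..t, M * ((Fintype.card V * M) ^ (n+1) * (t - r) ^ n / n.factorial)
        = ∫ r in (0:ℝ)..t, (M * ((Fintype.card V * M) ^ (n+1) / n.factorial)) * (t - r) ^ n := by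
          congr 1; ext r; ring
      _ = _ := by
          rw [intervalIntegral.integral_const_mul, hi, Nat.factorial_succ]
          push_cast
          field_simp

lemma iter_bound' {g : V → V → ℝ → ℝ} (hg : ∀ x y, Continuous (g x y)) (T : ℝ) :
    ∃ u : ℕ → ℝ, Summable u ∧ ∀ n x y, ∀ t ∈ Set.Icc 0 T, |iterConv g n x y t| ≤ u n := by
  obtain ⟨M, hM0, hM⟩ := exists_bound hg T
  refine ⟨fun n => M * ((Fintype.card V * M * T) ^ n / n.factorial),
    (Real.summable_pow_div_factorial _).mul_left _, fun n x y t ht => ?_⟩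
  refine (iter_bound T M hM0 hM n x y t ht).trans ?_
  rw [← mul_pow]
  beta_reduce
  have h0 := ht.1
  have h1 := ht.2
  gcongr

lemma iter_bound_f {f g : V → V → ℝ → ℝ} (hg : ∀ x y, Continuous (g x y))
    (h : ∀ x y t, 0 < t → f x y t = g x y t) (T : ℝ) :
    ∃ u : ℕ → ℝ, Summable u ∧ ∀ n x y, ∀ t ∈ Set.Icc 0 T, |iterConv f n x y t| ≤ u n := by
  obtain ⟨u, hu, hb⟩ := iter_bound' hg T
  refine ⟨fun n => u n + if n = 0 then ∑ x, ∑ y, |f x y 0| else 0,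
    hu.add (hasSum_ite_eq 0 _).summable, fun n x y t ht => ?_⟩
  have hbb := hb n x y t ht
  have hu0 : 0 ≤ u n := (abs_nonneg _).trans hbb
  have hS : |f x y 0| ≤ ∑ x, ∑ y, |f x y 0| :=
    calc |f x y 0| ≤ ∑ y, |f x y 0| := Finset.single_le_sum (f := fun y => |f x y 0|)
          (fun _ _ => abs_nonneg _) (Finset.mem_univ y)
      _ ≤ _ := Finset.single_le_sum (f := fun x => ∑ y, |f x y 0|)
          (fun _ _ => by positivity) (Finset.mem_univ x)
  have hS0 : 0 ≤ ∑ x, ∑ y, |f x y 0| := by positivity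
  rcases ht.1.eq_or_lt with h0 | h0
  · subst h0
    cases n with
    | zero => simpa [iterConv] using by linarith
    | succ n => simpa [iterConv, graphConv] using hu0
  · rw [iter_congr h n x y t h0]
    beta_reduce
    split_ifs <;> linarith

/-- The Neumann series for a continuous kernel, extended constantly to negative times. -/
noncomputable def neu (g : V → V → ℝ → ℝ) : V → V → ℝ → ℝ :=
  fun x y t => ∑' n : ℕ, (-1 : ℝ) ^ (n + 1) * iterConv g n x y (max t 0)

lemma neu_cont {g : V → V → ℝ → ℝ} (hg : ∀ x y, Continuous (g x y)) (x y : V) :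
    Continuous (neu g x y) := by
  rw [continuous_iff_continuousAt]
  intro t
  obtain ⟨u, hu, hb⟩ := iter_bound' hg (|t| + 1)
  have hc : ContinuousOn (neu g x y) (Set.Iio (|t| + 1)) := by
    unfold neu
    refine continuousOn_tsum (u := u) (fun n => ?_) hu fun n s hs => ?_
    · have := iter_cont hg n x y
      exact Continuous.continuousOn (by fun_prop)
    · rw [norm_mul]
      simp only [norm_pow, norm_neg, norm_one, one_pow, one_mul]
      refine hb n x y _ ⟨le_max_right _ _, max_le (le_of_lt hs) (by positivity)⟩
  exact hc.continuousAt (Iio_mem_nhds (by linarith [le_abs_self t]))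

lemma neu_hasSum {g : V → V → ℝ → ℝ} (hg : ∀ x y, Continuous (g x y)) (x y : V) (t : ℝ)
    (ht : 0 ≤ t) :
    HasSum (fun n : ℕ => (-1 : ℝ) ^ (n + 1) * iterConv g n x y t) (neu g x y t) := by
  obtain ⟨u, hu, hb⟩ := iter_bound' hg t
  have : Summable (fun n : ℕ => (-1 : ℝ) ^ (n + 1) * iterConv g n x y t) := by
    refine Summable.of_norm_bounded hu fun n => ?_
    rw [norm_mul]
    simp only [norm_pow, norm_neg, norm_one, one_pow, one_mul]
    exact hb n x y t ⟨ht, le_rfl⟩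
  unfold neu
  rw [max_eq_left ht]
  exact this.hasSum

lemma neu_resolvent {g : V → V → ℝ → ℝ} (hg : ∀ x y, Continuous (g x y)) (x y : V) (t : ℝ)
    (ht : 0 ≤ t) : g x y t + neu g x y t + graphConv g (neu g) x y t = 0 := by
  obtain ⟨u, hu, hb⟩ := iter_bound' hg t
  obtain ⟨M, hM0, hM⟩ := exists_bound hg t
  have h1 : HasSum (fun n : ℕ => ∫ r in (0:ℝ)..t,
      ∑ v : V, g x v (t - r) * ((-1 : ℝ) ^ (n + 1) * iterConv g n v y r))
      (graphConv g (neu g) x y t) := by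
    unfold graphConv
    refine intervalIntegral.hasSum_integral_of_dominated_convergence
      (fun n _ => Fintype.card V * (M * u n)) (fun n => ?_) (fun n => ?_) ?_ ?_ ?_
    · have := iter_cont hg n
      exact Continuous.aestronglyMeasurable (by fun_prop)
    · refine Filter.Eventually.of_forall fun r hr => ?_
      rw [Set.uIoc_of_le ht] at hr
      refine (norm_sum_le _ _).trans ?_
      have : ∀ v ∈ Finset.univ, ‖g x v (t - r) * ((-1 : ℝ) ^ (n + 1) * iterConv g n v y r)‖
          ≤ M * u n := by
        intro v _
        rw [norm_mul, norm_mul]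
        simp only [norm_pow, norm_neg, norm_one, one_pow, one_mul]
        exact mul_le_mul (hM _ _ _ ⟨by linarith [hr.2], by linarith [hr.1]⟩)
          (hb _ _ _ _ ⟨hr.1.le, hr.2⟩) (norm_nonneg _) hM0
      refine (Finset.sum_le_sum this).trans (le_of_eq ?_)
      rw [Finset.sum_const, Finset.card_univ, nsmul_eq_mul]
    · exact Filter.Eventually.of_forall fun r _ => (hu.mul_left _).mul_left _
    · exact intervalIntegrable_const
    · refine Filter.Eventually.of_forall fun r hr => ?_
      rw [Set.uIoc_of_le ht] at hr
      exact hasSum_sum fun v _ => (neu_hasSum hg v y r hr.1.le).mul_left _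
  have h2 : ∀ n : ℕ, ∫ r in (0:ℝ)..t,
      ∑ v : V, g x v (t - r) * ((-1 : ℝ) ^ (n + 1) * iterConv g n v y r)
      = (-1 : ℝ) ^ (n + 1) * iterConv g (n + 1) x y t := by
    intro n
    rw [← iter_comm hg n x y t ht]
    unfold graphConv
    rw [← intervalIntegral.integral_const_mul]
    refine intervalIntegral.integral_congr fun r _ => ?_
    beta_reduce
    rw [Finset.mul_sum]
    exact Finset.sum_congr rfl fun v _ => by ring
  simp_rw [h2] at h1
  have h3 := (hasSum_nat_add_iff' 1).2 (neu_hasSum hg x y t ht)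
  have h4 := h1.add h3
  have h5 : ∀ n : ℕ, (-1 : ℝ) ^ (n + 1) * iterConv g (n + 1) x y t
      + (-1 : ℝ) ^ (n + 1 + 1) * iterConv g (n + 1) x y t = 0 := fun n => by ring
  simp_rw [h5] at h4
  have h6 := h4.unique hasSum_zero
  simp [iterConv] at h6
  linarith

lemma conv_add_left {A A' B : V → V → ℝ → ℝ} (hA : ∀ x y, Continuous (A x y))
    (hA' : ∀ x y, Continuous (A' x y)) (hB : ∀ x y, Continuous (B x y)) (x y : V) (t : ℝ) :
    graphConv (fun a b s => A a b s + A' a b s) B x y t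
      = graphConv A B x y t + graphConv A' B x y t := by
  unfold graphConv
  rw [← intervalIntegral.integral_add (Continuous.intervalIntegrable (by fun_prop) _ _)
    (Continuous.intervalIntegrable (by fun_prop) _ _)]
  refine intervalIntegral.integral_congr fun r _ => ?_
  beta_reduce
  rw [← Finset.sum_add_distrib]
  exact Finset.sum_congr rfl fun v _ => by ring

lemma conv_one [DecidableEq V] (B : V → V → ℝ → ℝ) (x y : V) (t : ℝ) :
    graphConv (fun a b _ => if a = b then (1:ℝ) else 0) B x y t = ∫ r in (0:ℝ)..t, B x y r := by
  unfold graphConv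
  simp

lemma lap_cont (w : V → V → ℝ) {A : V → V → ℝ → ℝ} (hA : ∀ x y, Continuous (A x y)) (x y : V) :
    Continuous (graphLap w A x y) := by
  unfold graphLap
  fun_prop

lemma lap_conv (w : V → V → ℝ) {A B : V → V → ℝ → ℝ} (hA : ∀ x y, Continuous (A x y))
    (hB : ∀ x y, Continuous (B x y)) (x y : V) (t : ℝ) :
    graphLap w (graphConv A B) x y t = graphConv (graphLap w A) B x y t := by
  unfold graphLap graphConv
  have : ∀ v, ((∫ r in (0:ℝ)..t, ∑ u : V, A x u (t - r) * B u y r)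
      - ∫ r in (0:ℝ)..t, ∑ u : V, A v u (t - r) * B u y r) * w x v
      = ∫ r in (0:ℝ)..t, ∑ u : V, (A x u (t - r) - A v u (t - r)) * w x v * B u y r := by
    intro v
    rw [← intervalIntegral.integral_sub (Continuous.intervalIntegrable (by fun_prop) _ _)
      (Continuous.intervalIntegrable (by fun_prop) _ _), ← intervalIntegral.integral_mul_const]
    refine intervalIntegral.integral_congr fun r _ => ?_
    beta_reduce
    rw [← Finset.sum_sub_distrib, Finset.sum_mul]
    exact Finset.sum_congr rfl fun v _ => by ring
  simp_rw [this]
  rw [← intervalIntegral.integral_finsetSum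
    fun v _ => Continuous.intervalIntegrable (by fun_prop) _ _]
  refine intervalIntegral.integral_congr fun r _ => ?_
  beta_reduce
  rw [Finset.sum_comm]
  exact Finset.sum_congr rfl fun v _ => by rw [Finset.sum_mul]

lemma conv_bound {A B : V → V → ℝ → ℝ} {a b t : ℝ} (ht : 0 ≤ t) (ha : 0 ≤ a)
    (hA : ∀ x y, ∀ r ∈ Set.Ioo 0 t, |A x y r| ≤ a)
    (hB : ∀ x y, ∀ r ∈ Set.Ioo 0 t, |B x y r| ≤ b) (x y : V) :
    |graphConv A B x y t| ≤ Fintype.card V * (a * b) * t := by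
  unfold graphConv
  have := intervalIntegral.norm_integral_le_of_norm_le (μ := volume) (a := 0) (b := t)
    (f := fun r => ∑ v : V, A x v (t - r) * B v y r)
    (g := fun _ => Fintype.card V * (a * b)) ht ?_ intervalIntegrable_const
  · refine this.trans (le_of_eq ?_)
    simp
    ring
  · filter_upwards [volume.ae_ne t] with r hne hr
    have hr' : r < t := lt_of_le_of_ne hr.2 hne
    refine (norm_sum_le _ _).trans ?_
    have : ∀ v ∈ Finset.univ, ‖A x v (t - r) * B v y r‖ ≤ a * b := by
      intro v _
      rw [norm_mul]
      exact mul_le_mul (hA _ _ _ ⟨by linarith, by linarith [hr.1]⟩)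
        (hB _ _ _ ⟨hr.1, hr'⟩) (norm_nonneg _) ha
    refine (Finset.sum_le_sum this).trans (le_of_eq ?_)
    rw [Finset.sum_const, Finset.card_univ, nsmul_eq_mul]

end ParamAux

open ParamAux
/-- Theorem 3.2: the parametrix construction of the heat kernel on a finite weighted
graph.  If `H` is a parametrix of order `k`, `LH := L_x H`, and
`F := ∑_{ℓ=1}^∞ (−1)^ℓ (LH)^{∗ℓ}`, then the series defining `F` converges absolutely and
uniformly on compact subsets of `V × V × ℝ_{≥0}`, the function `H_G := H + H ∗ F` is the
heat kernel on `G` (it satisfies the heat equation and the Dirac initial condition), and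
`(H ∗ F)(x,y;t) = O(t^{k+1})` as `t → 0`. -/
theorem parametrix_construction_heat_kernel {V : Type*} [Fintype V] [DecidableEq V]
    (w : V → V → ℝ) (hw_symm : ∀ x y : V, w x y = w y x)
    (hw_nonneg : ∀ x y : V, 0 ≤ w x y)
    (H : V → V → ℝ → ℝ)
    (hHcont : ∀ x y : V, ContinuousOn (H x y) (Set.Ici 0))
    (hHsmooth : ∀ x y : V, ContDiffOn ℝ (⊤ : ℕ∞) (H x y) (Set.Ioi 0))
    (hH0 : ∀ x y : V, H x y 0 = if x = y then 1 else 0)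
    (hLext : ∀ x y : V, ∃ g : ℝ → ℝ, ContinuousOn g (Set.Ici 0) ∧
      Set.EqOn g (fun t => heatOp w H x y t) (Set.Ioi 0))
    -- H is a parametrix of order k : |L_x H(x,y;t)| = O(t^k) as t → 0
    (k : ℕ)
    (horder : ∃ (C : ℝ) (δ : ℝ), 0 < δ ∧ ∀ (x y : V) (t : ℝ), 0 < t → t < δ →
      |heatOp w H x y t| ≤ C * t ^ k) :
    -- the series ∑_{ℓ=1}^∞ (−1)^ℓ (L_x H)^{∗ℓ} converges absolutely and uniformly on
    -- every compact subset of V × V × ℝ_{≥0}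
    (∀ (x y : V) (t : ℝ), 0 ≤ t →
      Summable (fun n : ℕ => |iterConv (heatOp w H) n x y t|)) ∧
    (∀ K : Set ℝ, IsCompact K → K ⊆ Set.Ici 0 →
      TendstoUniformlyOn
        (fun (N : ℕ) (p : V × V × ℝ) =>
          ∑ n ∈ Finset.range N,
            (-1 : ℝ) ^ (n + 1) * iterConv (heatOp w H) n p.1 p.2.1 p.2.2)
        (fun p : V × V × ℝ =>
          ∑' n : ℕ, (-1 : ℝ) ^ (n + 1) * iterConv (heatOp w H) n p.1 p.2.1 p.2.2)
        Filter.atTop (Set.univ ×ˢ Set.univ ×ˢ K)) ∧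
    -- H_G := H + H ∗ F is the heat kernel on G
    (∀ (x y : V) (t : ℝ), 0 < t →
      heatOp w
        (fun a b s => H a b s +
          graphConv H
            (fun c d u => ∑' n : ℕ, (-1 : ℝ) ^ (n + 1) * iterConv (heatOp w H) n c d u)
            a b s) x y t = 0) ∧
    (∀ x y : V,
      Filter.Tendsto
        (fun t : ℝ => H x y t +
          graphConv H
            (fun c d u => ∑' n : ℕ, (-1 : ℝ) ^ (n + 1) * iterConv (heatOp w H) n c d u)
            x y t)
        (nhdsWithin 0 (Set.Ioi 0)) (nhds (if x = y then 1 else 0))) ∧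
    -- (H ∗ F)(x,y;t) = O(t^{k+1}) as t → 0
    (∃ (C' : ℝ) (δ' : ℝ), 0 < δ' ∧ ∀ (x y : V) (t : ℝ), 0 < t → t < δ' →
      |graphConv H
          (fun c d u => ∑' n : ℕ, (-1 : ℝ) ^ (n + 1) * iterConv (heatOp w H) n c d u)
          x y t| ≤ C' * t ^ (k + 1)) := by
  choose g0 hg0c hg0e using hLext
  set f := heatOp w H with hf
  set g : V → V → ℝ → ℝ := fun x y t => g0 x y (max t 0) with hgdef
  set Hh : V → V → ℝ → ℝ := fun x y t => H x y (max t 0) with hHdef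
  have hg : ∀ x y, Continuous (g x y) := fun x y =>
    (hg0c x y).comp_continuous (continuous_id.max continuous_const) fun t => Set.mem_Ici.2 (le_max_right _ _)
  have hHh : ∀ x y, Continuous (Hh x y) := fun x y =>
    (hHcont x y).comp_continuous (continuous_id.max continuous_const) fun t => Set.mem_Ici.2 (le_max_right _ _)
  have hHeq : ∀ x y t, 0 ≤ t → H x y t = Hh x y t := fun x y t ht => by
    simp only [hHdef, max_eq_left ht]
  have hfg : ∀ x y t, 0 < t → f x y t = g x y t := fun x y t ht => by
    simp only [hgdef, max_eq_left ht.le]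
    exact (hg0e x y ht).symm
  set F : V → V → ℝ → ℝ :=
    fun c d u => ∑' n : ℕ, (-1 : ℝ) ^ (n + 1) * iterConv f n c d u with hF
  have hFeq : ∀ x y t, 0 < t → F x y t = neu g x y t := fun x y t ht => by
    simp only [hF, neu, max_eq_left ht.le]
    exact tsum_congr fun n => by rw [iter_congr hfg n x y t ht]
  have hΦ := neu_cont hg
  have hconv : ∀ x y t, 0 ≤ t → graphConv H F x y t = graphConv Hh (neu g) x y t :=
    conv_congr (fun x y t ht => hHeq x y t ht.le) hFeq
  have hdiff : ∀ x y t, 0 < t → HasDerivAt (H x y) (deriv (H x y) t) t := fun x y t ht =>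
    (((hHsmooth x y).differentiableOn (by simp)).differentiableAt (Ioi_mem_nhds ht)).hasDerivAt
  set h : V → V → ℝ → ℝ := fun x y t => g x y t - graphLap w Hh x y t with hh
  have hhc : ∀ x y, Continuous (h x y) := fun x y => (hg x y).sub (lap_cont w hHh x y)
  have hlapeq : ∀ x y t, 0 ≤ t → graphLap w H x y t = graphLap w Hh x y t := fun x y t ht => by
    unfold graphLap
    exact Finset.sum_congr rfl fun v _ => by rw [hHeq _ _ _ ht, hHeq _ _ _ ht]
  have hderivH : ∀ x y t, 0 < t → deriv (H x y) t = h x y t := fun x y t ht => by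
    have : f x y t = graphLap w H x y t + deriv (H x y) t := rfl
    simp only [hh]
    rw [← hfg x y t ht, ← hlapeq x y t ht.le, this]
    ring
  let I : V → V → ℝ → ℝ := fun a b _ => if a = b then (1:ℝ) else 0
  have hI : ∀ x y, Continuous (I x y) := fun x y => continuous_const
  have hHI : ∀ x y t, 0 < t → Hh x y t = I x y t + graphConv I h x y t := fun x y t ht => by
    have : graphConv I h x y t = ∫ r in (0:ℝ)..t, h x y r := conv_one h x y t
    rw [this, intervalIntegral.integral_eq_sub_of_hasDerivAt_of_le ht.le
      ((hHcont x y).mono fun s hs => hs.1)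
      (fun s hs => (hderivH x y s hs.1) ▸ hdiff x y s hs.1)
      ((hhc x y).intervalIntegrable _ _), hH0, ← hHeq x y t ht.le]
    simp [I]
  have hkey : ∀ x y t, 0 ≤ t → graphConv H F x y t
      = ∫ r in (0:ℝ)..t, (neu g x y r + graphConv h (neu g) x y r) := fun x y t ht => by
    rw [hconv x y t ht, conv_congr (B' := neu g) hHI (fun _ _ _ _ => rfl) x y t ht,
      conv_add_left hI (conv_cont hI hhc) hΦ, conv_assoc hI hhc hΦ x y t ht,
      intervalIntegral.integral_add ((hΦ x y).intervalIntegrable _ _)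
        ((conv_cont hhc hΦ x y).intervalIntegrable _ _)]
    congr 1
    · exact conv_one _ x y t
    · exact conv_one _ x y t
  refine ⟨fun x y t ht => ?_, fun K hK hK0 => ?_, fun x y t ht => ?_, fun x y => ?_, ?_⟩
  · obtain ⟨u, hu, hb⟩ := iter_bound_f hg hfg t
    exact Summable.of_nonneg_of_le (fun _ => abs_nonneg _)
      (fun n => hb n x y t ⟨ht, le_rfl⟩) hu
  · obtain ⟨T, hT⟩ := hK.bddAbove
    obtain ⟨u, hu, hb⟩ := iter_bound_f hg hfg T
    refine tendstoUniformlyOn_tsum_nat hu ?_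
    rintro n ⟨x, y, t⟩ ⟨-, -, ht⟩
    rw [norm_mul]
    simp only [norm_pow, norm_neg, norm_one, one_pow, one_mul]
    exact hb n x y t ⟨hK0 ht, hT ht⟩
  · have hd : HasDerivAt (fun s => H x y s + graphConv H F x y s)
        (h x y t + (neu g x y t + graphConv h (neu g) x y t)) t := by
      refine HasDerivAt.add (hderivH x y t ht ▸ hdiff x y t ht) ?_
      have hc : Continuous fun r => neu g x y r + graphConv h (neu g) x y r :=
        (hΦ x y).add (conv_cont hhc hΦ x y)
      refine (intervalIntegral.integral_hasDerivAt_right (hc.intervalIntegrable 0 t)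
        (hc.stronglyMeasurableAtFilter _ _) hc.continuousAt).congr_of_eventuallyEq ?_
      filter_upwards [Ioi_mem_nhds ht] with s hs
      exact hkey x y s (le_of_lt hs)
    have hl : graphLap w (fun a b s => H a b s + graphConv H F a b s) x y t
        = graphLap w Hh x y t + graphConv (graphLap w Hh) (neu g) x y t := by
      rw [← lap_conv w hHh hΦ]
      unfold graphLap
      rw [← Finset.sum_add_distrib]
      refine Finset.sum_congr rfl fun v _ => ?_
      beta_reduce
      rw [hHeq x y t ht.le, hHeq v y t ht.le, hconv x y t ht.le, hconv v y t ht.le]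
      ring
    have hs : graphConv g (neu g) x y t
        = graphConv h (neu g) x y t + graphConv (graphLap w Hh) (neu g) x y t := by
      rw [← conv_add_left hhc (lap_cont w hHh) hΦ]
      exact conv_congr (fun x y t _ => by simp [hh]) (fun _ _ _ _ => rfl) x y t ht.le
    have hr := neu_resolvent hg x y t ht.le
    unfold heatOp
    rw [hl, hd.deriv]
    have : h x y t = g x y t - graphLap w Hh x y t := rfl
    linarith
  · have hc : Continuous fun t => Hh x y t + graphConv Hh (neu g) x y t :=
      (hHh x y).add (conv_cont hHh hΦ x y)
    have h0 := (hc.tendsto 0).mono_left (nhdsWithin_le_nhds (s := Set.Ioi 0))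
    have hv : Hh x y 0 + graphConv Hh (neu g) x y 0 = if x = y then 1 else 0 := by
      rw [← hHeq x y 0 le_rfl, hH0]
      simp [graphConv]
    rw [hv] at h0
    refine h0.congr' ?_
    filter_upwards [self_mem_nhdsWithin] with t ht
    rw [hHeq x y t (le_of_lt ht), hconv x y t (le_of_lt ht)]
  · obtain ⟨C, δ, hδ, hC⟩ := horder
    obtain ⟨M, hM0, hM⟩ := exists_bound hΦ 1
    obtain ⟨N, hN0, hN⟩ := exists_bound hHh 1
    have hgk : ∀ x y t, 0 < t → t < δ → |g x y t| ≤ |C| * t ^ k := fun x y t h1 h2 => by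
      rw [← hfg x y t h1]
      exact (hC x y t h1 h2).trans (by gcongr; exact le_abs_self C)
    have hΦk : ∀ x y t, 0 < t → t < min δ 1 →
        |neu g x y t| ≤ (|C| + Fintype.card V * (|C| * M)) * t ^ k := by
      intro x y t h1 h2
      have h2a := h2.trans_le (min_le_left _ _)
      have h2b := h2.trans_le (min_le_right _ _)
      have hr := neu_resolvent hg x y t h1.le
      have hb : |graphConv g (neu g) x y t| ≤ Fintype.card V * (|C| * t ^ k * M) * t := by
        refine conv_bound h1.le (by positivity) (fun x y r hr => ?_) (fun x y r hr => ?_) x y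
        · refine (hgk x y r hr.1 (hr.2.trans h2a)).trans ?_
          have := hr.1.le
          have := hr.2.le
          gcongr
        · exact hM x y r ⟨hr.1.le, (hr.2.trans h2b).le⟩
      have hb2 : Fintype.card V * (|C| * t ^ k * M) * t ≤ Fintype.card V * (|C| * t ^ k * M) :=
        mul_le_of_le_one_right (by positivity) h2b.le
      have he : neu g x y t = -(g x y t + graphConv g (neu g) x y t) := by linarith
      rw [he, abs_neg]
      refine (abs_add_le _ _).trans ?_
      have := hgk x y t h1 h2a
      linarith
    refine ⟨Fintype.card V * (N * (|C| + Fintype.card V * (|C| * M))), min δ 1, by positivity,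
      fun x y t h1 h2 => ?_⟩
    rw [hconv x y t h1.le]
    have h2b := h2.trans_le (min_le_right _ _)
    refine (conv_bound (a := N) (b := (|C| + Fintype.card V * (|C| * M)) * t ^ k)
      h1.le hN0 (fun x y r hr => ?_) (fun x y r hr => ?_) x y).trans (le_of_eq ?_)
    · exact hN x y r ⟨hr.1.le, (hr.2.trans h2b).le⟩
    · refine (hΦk x y r hr.1 (hr.2.trans h2)).trans ?_
      have := hr.1.le
      have := hr.2.le
      gcongr
    · ring
end

section
/- Let G be a graph on vertex set {1,…,N} with symmetric weights w(x,y) ∈ {0,1} and w(x,x) = 0 (a subgraph of K_N), and let B be the N × N matrix with B_{xx} = #{y ≠ x : w(x,y) = 0}, B_{xy} = −1 if x ≠ y and w(x,y) = 0, and B_{xy} = 0 if w(x,y) = 1 (the Laplacian matrix of the complement of G in K_N). Then the function H_G(x,y;t) = H_{K_N}(x,y;t) + e^{−Nt} ∑_{ℓ=1}^∞ (t^ℓ/ℓ!)(B^ℓ)_{xy} is the heat kernel on G: it satisfies ∂_t H_G(x,y;t) + ∑_{v}(H_G(x,y;t) − H_G(v,y;t))w(x,v) = 0 for all t > 0, and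 H_G(x,y;0) = 1 if x = y and 0 otherwise. -/
/-- The heat kernel on the complete graph `K_N`. -/
noncomputable def heatKernelKN (N : ℕ) (x y : Fin N) (t : ℝ) : ℝ :=
  if x = y then 1 / N + (1 - 1 / N) * Real.exp (-(N : ℝ) * t)
  else 1 / N - (1 / N) * Real.exp (-(N : ℝ) * t)

/-- Entrywise exponential: series, derivative. -/
theorem exp_entry_facts (N : ℕ) (B : Matrix (Fin N) (Fin N) ℝ) :
    ∃ E : ℝ → Matrix (Fin N) (Fin N) ℝ,
      (∀ t x y, HasSum (fun n : ℕ => t ^ n / (n.factorial : ℝ) * (B ^ n) x y) (E t x y)) ∧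
      (∀ t x y, HasDerivAt (fun s => E s x y) ((B * E t) x y) t) := by
  let _ := Matrix.linftyOpNormedRing (n := Fin N) (α := ℝ)
  let _ := Matrix.linftyOpNormedAlgebra (n := Fin N) (R := ℝ) (α := ℝ)
  have hc : ∀ x y : Fin N, Continuous (fun M : Matrix (Fin N) (Fin N) ℝ => M x y) :=
    fun x y => by fun_prop
  refine ⟨fun t => NormedSpace.exp (t • B), fun t x y => ?_, fun t x y => ?_⟩
  · have h := NormedSpace.exp_series_hasSum_exp' (𝕂 := ℝ) (t • B)
    have h2 := h.map (Matrix.entryAddMonoidHom ℝ x y) (hc x y)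
    convert h2 using 1
    · funext n
      simp [Function.comp, smul_pow, div_eq_mul_inv]
      ring
    · rfl
  · have h := hasDerivAt_exp_smul_const' (𝕂 := ℝ) B t
    let L : Matrix (Fin N) (Fin N) ℝ →L[ℝ] ℝ := ⟨Matrix.entryLinearMap ℝ ℝ x y, hc x y⟩
    exact L.hasFDerivAt.comp_hasDerivAt t h

/-- For a subgraph `G` of `K_N` (with `{0,1}`-valued symmetric weights `w` vanishing on
the diagonal), let `B` be the Laplacian matrix of the complement of `G` in `K_N`.  Then
`H_G(x,y;t) = H_{K_N}(x,y;t) + e^{−Nt} ∑_{ℓ=1}^∞ (t^ℓ/ℓ!)(B^ℓ)_{xy}` is the heat kernel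
on `G`. -/
theorem heat_kernel_subgraph_of_complete_graph (N : ℕ)
    (w : Fin N → Fin N → ℝ)
    (hw01 : ∀ x y : Fin N, w x y = 0 ∨ w x y = 1)
    (hw_symm : ∀ x y : Fin N, w x y = w y x)
    (hw_diag : ∀ x : Fin N, w x x = 0)
    (B : Matrix (Fin N) (Fin N) ℝ)
    (hBdiag : ∀ x : Fin N,
      B x x = ((Finset.univ.erase x).filter (fun z => w x z = 0)).card)
    (hBoff₀ : ∀ x y : Fin N, x ≠ y → w x y = 0 → B x y = -1)
    (hBoff₁ : ∀ x y : Fin N, w x y = 1 → B x y = 0)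
    (HG : Fin N → Fin N → ℝ → ℝ)
    (hHG : ∀ (x y : Fin N) (t : ℝ),
      HG x y t = heatKernelKN N x y t +
        Real.exp (-(N : ℝ) * t) *
          ∑' ℓ : ℕ, t ^ (ℓ + 1) / ((ℓ + 1).factorial : ℝ) * (B ^ (ℓ + 1)) x y)
    (x y : Fin N) :
    (∀ t : ℝ, 0 < t →
      deriv (fun s : ℝ => HG x y s) t +
        ∑ v : Fin N, (HG x y t - HG v y t) * w x v = 0) ∧
    HG x y 0 = if x = y then 1 else 0 := by
  obtain ⟨E, hE, hE'⟩ := exp_entry_facts N B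
  have hN : (N : ℝ) ≠ 0 := by
    have := x.pos
    positivity
  -- closed form
  have key : ∀ x y t, HG x y t = 1 / N - 1 / N * Real.exp (-(N : ℝ) * t)
      + Real.exp (-(N : ℝ) * t) * E t x y := by
    intro x y t
    have h1 := (hE t x y).summable.tsum_eq_zero_add
    rw [(hE t x y).tsum_eq] at h1
    simp only [pow_zero, Nat.factorial_zero, Nat.cast_one, Matrix.one_apply] at h1
    rw [hHG, h1]
    unfold heatKernelKN
    split_ifs <;> ring
  -- off-diagonal and Laplacian row formula
  have hoff : ∀ a v, a ≠ v → B a v = w a v - 1 := by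
    intro a v h
    rcases hw01 a v with h0 | h1
    · rw [hBoff₀ a v h h0, h0]; ring
    · rw [hBoff₁ a v h1, h1]; ring
  have hdiag : ∀ a, B a a = ∑ v ∈ Finset.univ.erase a, (1 - w a v) := by
    intro a
    rw [hBdiag, Finset.card_filter]
    push_cast
    refine Finset.sum_congr rfl fun v _ => ?_
    rcases hw01 a v with h0 | h1
    · simp [h0]
    · simp [h1]
  have hrow : ∀ a (f : Fin N → ℝ),
      ∑ v, B a v * f v = ∑ v, (1 - w a v) * (f a - f v) := by
    intro a f
    rw [← Finset.add_sum_erase _ _ (Finset.mem_univ a),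
      ← Finset.add_sum_erase _ (fun v => (1 - w a v) * (f a - f v)) (Finset.mem_univ a),
      hdiag, Finset.sum_mul, ← Finset.sum_add_distrib, sub_self, mul_zero, zero_add]
    refine Finset.sum_congr rfl fun v hv => ?_
    rw [hoff a v (Finset.ne_of_mem_erase hv).symm]
    ring
  have hsymm : ∀ a b, B a b = B b a := by
    intro a b
    by_cases h : a = b
    · rw [h]
    · rw [hoff a b h, hoff b a (Ne.symm h), hw_symm]
  have hcol : ∀ b, ∑ v, B v b = 0 := by
    intro b
    have := hrow b (fun _ => 1)
    simp only [mul_one, sub_self, mul_zero, Finset.sum_const_zero] at this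
    rw [← this]
    exact Finset.sum_congr rfl fun v _ => hsymm v b
  have hpow : ∀ n b, ∑ v, (B ^ (n + 1)) v b = 0 := by
    intro n b
    simp only [pow_succ', Matrix.mul_apply]
    rw [Finset.sum_comm]
    simp only [← Finset.sum_mul, hcol, zero_mul, Finset.sum_const_zero]
  have hsum : ∀ t b, ∑ v, E t v b = 1 := by
    intro t b
    have h1 := hasSum_sum (s := Finset.univ) (fun v _ => hE t v b)
    have h2 : HasSum (fun n : ℕ => ∑ v, t ^ n / (n.factorial : ℝ) * (B ^ n) v b) 1 := by
      have := hasSum_single (f := fun n : ℕ => ∑ v, t ^ n / (n.factorial : ℝ) * (B ^ n) v b) 0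
        (by
          intro n hn
          obtain ⟨m, rfl⟩ := Nat.exists_eq_succ_of_ne_zero hn
          rw [← Finset.mul_sum, Nat.succ_eq_add_one, hpow, mul_zero])
      simpa [Matrix.one_apply] using this
    exact h1.unique h2
  constructor
  · intro t _
    have hexp : HasDerivAt (fun s : ℝ => Real.exp (-(N : ℝ) * s))
        (Real.exp (-(N : ℝ) * t) * (-(N : ℝ) * 1)) t :=
      ((hasDerivAt_id t).const_mul (-(N : ℝ))).exp
    have hd := ((hexp.const_mul (1 / (N : ℝ))).const_sub (1 / (N : ℝ))).add
      (hexp.mul (hE' t x y))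
    have hfun : (fun s => HG x y s) = fun s => 1 / (N : ℝ) - 1 / N * Real.exp (-(N : ℝ) * s)
      + Real.exp (-(N : ℝ) * s) * E s x y := funext fun s => key x y s
    rw [hfun]
    have hd2 := hd.deriv
    refine (congrArg (· + _) hd2).trans ?_
    have hL : ∑ v, (HG x y t - HG v y t) * w x v
        = Real.exp (-(N : ℝ) * t) * ∑ v, (E t x y - E t v y) * w x v := by
      rw [Finset.mul_sum]
      refine Finset.sum_congr rfl fun v _ => ?_
      rw [key, key]; ring
    have hBE : (B * E t) x y = N * E t x y - 1 - ∑ v, (E t x y - E t v y) * w x v := by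
      rw [Matrix.mul_apply, hrow x (fun v => E t v y)]
      have : (N : ℝ) * E t x y = ∑ v : Fin N, E t x y := by simp
      have h1 : (N : ℝ) * E t x y - 1 = ∑ v : Fin N, E t x y - ∑ v, E t v y := by
        rw [this, hsum]
      rw [h1, ← Finset.sum_sub_distrib, ← Finset.sum_sub_distrib]
      exact Finset.sum_congr rfl fun v _ => by ring
    simp only [hL, hBE]
    field_simp
    ring
  · have hE0 : E 0 x y = (1 : Matrix (Fin N) (Fin N) ℝ) x y := by
      refine (hE 0 x y).unique ?_
      have := hasSum_single (f := fun n : ℕ => (0 : ℝ) ^ n / (n.factorial : ℝ) * (B ^ n) x y) 0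
        (by intro n hn; simp [hn])
      simpa using this
    rw [key, hE0, Matrix.one_apply]
    simp
end

section
/- Let G be a graph on vertex set {1,…,N} with symmetric weights w(x,y) ∈ {0,1} and w(x,x) = 0 (a subgraph of K_N), and let B be the N × N matrix with B_{xx} = #{y ≠ x : w(x,y) = 0}, B_{xy} = −1 if x ≠ y and w(x,y) = 0, and B_{xy} = 0 if w(x,y) = 1. Let L_x denote the heat operator of G acting in the first variable. Then for every integer ℓ ≥ 1, every x, y ∈ {1,…,N} and every t > 0, (H_{K_N} ∗ (L_x H_{K_N})^{∗ℓ})(x,y;t) = (−1)^ℓ (t^ℓ/ℓ!) e^{−Nt} (B^ℓ)_{xy}. -/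
open MeasureTheory

theorem aux_kernel_eq (N : ℕ) (x y : Fin N) (t : ℝ) :
    heatKernelKN N x y t = 1 / N + ((if x = y then 1 else 0) - 1 / N) * Real.exp (-(N : ℝ) * t) := by
  unfold heatKernelKN
  split_ifs <;> ring

theorem aux_B_eq (N : ℕ)
    (w : Fin N → Fin N → ℝ)
    (hw01 : ∀ x y : Fin N, w x y = 0 ∨ w x y = 1)
    (hw_diag : ∀ x : Fin N, w x x = 0)
    (B : Matrix (Fin N) (Fin N) ℝ)
    (hBdiag : ∀ x : Fin N,
      B x x = ((Finset.univ.erase x).filter (fun z => w x z = 0)).card)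
    (hBoff₀ : ∀ x y : Fin N, x ≠ y → w x y = 0 → B x y = -1)
    (hBoff₁ : ∀ x y : Fin N, w x y = 1 → B x y = 0) (x y : Fin N) :
    B x y = (if x = y then ((N : ℝ) - ∑ z, w x z) else 0) - 1 + w x y := by
  by_cases h : x = y
  · subst h
    have h1 : (((Finset.univ.erase x).filter (fun z => w x z = 0)).card : ℝ)
        = ∑ z ∈ Finset.univ.erase x, (1 - w x z) := by
      rw [Finset.card_filter]
      push_cast
      refine Finset.sum_congr rfl fun z _ => ?_
      rcases hw01 x z with h | h <;> simp [h]
    have h2 := Finset.sum_erase_add Finset.univ (fun z => 1 - w x z) (Finset.mem_univ x)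
    have h3 : ∑ z, (1 - w x z) = (N : ℝ) - ∑ z, w x z := by
      rw [Finset.sum_sub_distrib]; simp
    rw [hBdiag, h1, if_pos rfl, ← h3, ← h2, hw_diag]
    ring
  · rw [if_neg h]
    rcases hw01 x y with h' | h'
    · rw [hBoff₀ x y h h', h']; ring
    · rw [hBoff₁ x y h', h']; ring

theorem aux_heatOp (N : ℕ) (w : Fin N → Fin N → ℝ)
    (B : Matrix (Fin N) (Fin N) ℝ)
    (hB : ∀ x y, B x y = (if x = y then ((N : ℝ) - ∑ z, w x z) else 0) - 1 + w x y)
    (x y : Fin N) (t : ℝ) :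
    heatOp w (heatKernelKN N) x y t = - Real.exp (-(N : ℝ) * t) * B x y := by
  have hN : (N : ℝ) ≠ 0 := by
    have := x.pos
    positivity
  have hd : HasDerivAt (fun s => heatKernelKN N x y s)
      (((if x = y then 1 else 0) - 1 / N) * (Real.exp (-(N : ℝ) * t) * (-(N : ℝ) * 1))) t := by
    simp only [aux_kernel_eq]
    exact (((hasDerivAt_id t).const_mul (-(N : ℝ))).exp.const_mul _).const_add _
  have hs : ∑ v, (heatKernelKN N x y t - heatKernelKN N v y t) * w x v
      = Real.exp (-(N : ℝ) * t) * ((if x = y then 1 else 0) * ∑ v, w x v - w x y) := by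
    have h1 : ∀ v, (heatKernelKN N x y t - heatKernelKN N v y t) * w x v
      = Real.exp (-(N : ℝ) * t) * ((if x = y then 1 else 0) * w x v
          - (if v = y then w x v else 0)) := by
      intro v
      rw [aux_kernel_eq, aux_kernel_eq]
      split_ifs <;> ring
    rw [Finset.sum_congr rfl fun v _ => h1 v, ← Finset.mul_sum, Finset.sum_sub_distrib,
      ← Finset.mul_sum]
    simp
  unfold heatOp graphLap
  rw [hd.deriv, hs, hB]
  split_ifs <;> field_simp <;> ring

theorem aux_iter (N : ℕ) (f : Fin N → Fin N → ℝ → ℝ) (B : Matrix (Fin N) (Fin N) ℝ)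
    (hf : ∀ x y t, f x y t = - Real.exp (-(N : ℝ) * t) * B x y) (n : ℕ) :
    ∀ (x y : Fin N) (t : ℝ), iterConv f n x y t =
      (-1 : ℝ) ^ (n + 1) * (t ^ n / (n.factorial : ℝ)) *
        Real.exp (-(N : ℝ) * t) * (B ^ (n + 1)) x y := by
  induction n with
  | zero => intro x y t; simp [iterConv, hf]
  | succ n ih =>
    intro x y t
    have h1 : ∀ r : ℝ, ∑ v, iterConv f n x v (t - r) * f v y r
        = ((-1 : ℝ) ^ (n + 2) * Real.exp (-(N : ℝ) * t) * (B ^ (n + 2)) x y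
            / (n.factorial : ℝ)) * (t - r) ^ n := by
      intro r
      have he : Real.exp (-(N : ℝ) * t)
          = Real.exp (-(N : ℝ) * (t - r)) * Real.exp (-(N : ℝ) * r) := by
        rw [← Real.exp_add]; congr 1; ring
      rw [he, pow_succ B (n + 1), Matrix.mul_apply, Finset.mul_sum, Finset.sum_div, Finset.sum_mul]
      refine Finset.sum_congr rfl fun v _ => ?_
      rw [ih, hf]
      ring
    have h2 : ∫ r in (0:ℝ)..t, (t - r) ^ n = t ^ (n + 1) / (n + 1) := by
      rw [intervalIntegral.integral_comp_sub_left (fun r => r ^ n) t, integral_pow]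
      simp
    have hn : (n.factorial : ℝ) ≠ 0 := by positivity
    have hn' : (n : ℝ) + 1 ≠ 0 := by positivity
    simp only [iterConv, graphConv, h1]
    rw [intervalIntegral.integral_const_mul, h2, Nat.factorial_succ]
    push_cast
    field_simp

/-- For a subgraph `G` of `K_N` with complement Laplacian matrix `B` and heat operator
`L_x` of `G`, one has `(H_{K_N} ∗ (L_x H_{K_N})^{∗ℓ})(x,y;t) = (−1)^ℓ (t^ℓ/ℓ!) e^{−Nt} (B^ℓ)_{xy}`
for every `ℓ ≥ 1` (here `ℓ = n + 1`). -/
theorem conv_heatKernelKN_iter (N : ℕ)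
    (w : Fin N → Fin N → ℝ)
    (hw01 : ∀ x y : Fin N, w x y = 0 ∨ w x y = 1)
    (hw_symm : ∀ x y : Fin N, w x y = w y x)
    (hw_diag : ∀ x : Fin N, w x x = 0)
    (B : Matrix (Fin N) (Fin N) ℝ)
    (hBdiag : ∀ x : Fin N,
      B x x = ((Finset.univ.erase x).filter (fun z => w x z = 0)).card)
    (hBoff₀ : ∀ x y : Fin N, x ≠ y → w x y = 0 → B x y = -1)
    (hBoff₁ : ∀ x y : Fin N, w x y = 1 → B x y = 0)
    (n : ℕ) (x y : Fin N) (t : ℝ) (ht : 0 < t) :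
    graphConv (heatKernelKN N) (iterConv (heatOp w (heatKernelKN N)) n) x y t =
      (-1 : ℝ) ^ (n + 1) * (t ^ (n + 1) / ((n + 1).factorial : ℝ)) *
        Real.exp (-(N : ℝ) * t) * (B ^ (n + 1)) x y := by
  have hB := aux_B_eq N w hw01 hw_diag B hBdiag hBoff₀ hBoff₁
  have hi := aux_iter N _ B (aux_heatOp N w B hB) n
  have hcol : ∀ y, ∑ v, B v y = 0 := by
    intro y
    simp only [hB, Finset.sum_add_distrib, Finset.sum_sub_distrib, Finset.sum_ite_eq',
      Finset.mem_univ, if_true]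
    rw [Finset.sum_congr rfl fun z _ => hw_symm y z]
    simp
  have hcol' : ∑ v, (B ^ (n + 1)) v y = 0 := by
    rw [pow_succ']
    simp only [Matrix.mul_apply]
    rw [Finset.sum_comm]
    simp [← Finset.sum_mul, hcol]
  have h1 : ∀ r : ℝ, ∑ v, heatKernelKN N x v (t - r)
        * iterConv (heatOp w (heatKernelKN N)) n v y r
      = ((-1 : ℝ) ^ (n + 1) * Real.exp (-(N : ℝ) * t) * (B ^ (n + 1)) x y
            / (n.factorial : ℝ)) * r ^ n := by
    intro r
    have he : Real.exp (-(N : ℝ) * t)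
        = Real.exp (-(N : ℝ) * (t - r)) * Real.exp (-(N : ℝ) * r) := by
      rw [← Real.exp_add]; congr 1; ring
    have h3 : ∀ v, heatKernelKN N x v (t - r) * iterConv (heatOp w (heatKernelKN N)) n v y r
        = (1 / N - 1 / N * Real.exp (-(N : ℝ) * (t - r)))
            * ((-1 : ℝ) ^ (n + 1) * (r ^ n / (n.factorial : ℝ)) * Real.exp (-(N : ℝ) * r))
            * (B ^ (n + 1)) v y
          + (if x = v then Real.exp (-(N : ℝ) * (t - r))
            * ((-1 : ℝ) ^ (n + 1) * (r ^ n / (n.factorial : ℝ)) * Real.exp (-(N : ℝ) * r))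
            * (B ^ (n + 1)) v y else 0) := by
      intro v
      rw [hi, aux_kernel_eq]
      split_ifs <;> ring
    rw [Finset.sum_congr rfl fun v _ => h3 v, Finset.sum_add_distrib, ← Finset.mul_sum, hcol',
      Finset.sum_ite_eq, if_pos (Finset.mem_univ x), he]
    ring
  have hn : (n.factorial : ℝ) ≠ 0 := by positivity
  have hn' : (n : ℝ) + 1 ≠ 0 := by positivity
  simp only [graphConv, h1]
  rw [intervalIntegral.integral_const_mul, integral_pow, Nat.factorial_succ]
  push_cast
  field_simp
  simp
end

section
/- Let N ≥ 2 and let G be the graph obtained from the complete graph K_N by deleting the edge between vertices 1 and 2. Then the heat kernel H_G of G is given by: H_G(x,y;t) = H_{K_N}(x,y;t) unless both x, y ∈ {1,2}; H_G(x,x;t) = H_{K_N}(x,x;t) + e^{−Nt}(e^{2t} − 1)/2 for x ∈ {1,2}; and H_G(x,y;t) = H_{K_N}(x,y;t) − e^{−Nt}(e^{2t} − 1)/2 for x, y ∈ {1,2} with x ≠ y. That is, this function satisfies ∂_t H_G(x,y;t) + ∑_v (H_G(x,y;t) − H_G(v,y;t)) w(x,v) = 0 for t > 0, where w(x,v) =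 1 for x ≠ v except w(1,2) = w(2,1) = 0, and H_G(x,y;0) = 1 if x = y and 0 otherwise. -/
/-- The heat kernel on the complete graph `K_N` with the edge between the vertices
`a = 0` and `b = 1` deleted: it agrees with `H_{K_N}` unless both vertices lie in
`{a,b}`, where it is corrected by `± e^{−Nt}(e^{2t} − 1)/2`. -/
noncomputable def heatKernelDeletedEdge (N : ℕ) (a b x y : Fin N) (t : ℝ) : ℝ :=
  if (x = a ∨ x = b) ∧ (y = a ∨ y = b) then
    (if x = y then
      heatKernelKN N x y t + Real.exp (-(N : ℝ) * t) * (Real.exp (2 * t) - 1) / 2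
    else
      heatKernelKN N x y t - Real.exp (-(N : ℝ) * t) * (Real.exp (2 * t) - 1) / 2)
  else heatKernelKN N x y t

/-- Signed indicator of the deleted edge. -/
noncomputable def edgeSign (N : ℕ) (a b x : Fin N) : ℝ :=
  (if x = a then 1 else 0) - (if x = b then 1 else 0)

theorem heatKernelDeletedEdge_eq (N : ℕ) (a b x y : Fin N) (hab : a ≠ b) (t : ℝ) :
    heatKernelDeletedEdge N a b x y t =
      1 / N + ((if x = y then 1 else 0) - 1 / N) * Real.exp (-(N : ℝ) * t) +
      edgeSign N a b x * edgeSign N a b y *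
        (Real.exp (-(N : ℝ) * t) * (Real.exp (2 * t) - 1) / 2) := by
  have hba := hab.symm
  unfold heatKernelDeletedEdge heatKernelKN edgeSign
  by_cases h1 : x = a <;> by_cases h2 : x = b <;> by_cases h3 : y = a <;>
    by_cases h4 : y = b <;> by_cases h5 : x = y <;> subst_vars <;>
    simp_all <;> ring

theorem heatKernelDeletedEdge_sum (N : ℕ) (hN : (N : ℝ) ≠ 0) (a b y : Fin N)
    (hab : a ≠ b) (t : ℝ) :
    ∑ v : Fin N, heatKernelDeletedEdge N a b v y t = 1 := by
  simp only [heatKernelDeletedEdge_eq N a b _ y hab, Finset.sum_add_distrib, ← Finset.sum_mul,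
    Finset.sum_sub_distrib, edgeSign]
  simp
  field_simp
  simp

/-- Deleting one edge from the complete graph: the function `heatKernelDeletedEdge`
is the heat kernel on the graph obtained from `K_N` by deleting the edge between
vertices `0` and `1`. -/
theorem heat_kernel_complete_graph_deleted_edge (N : ℕ) (hN : 2 ≤ N)
    (a b : Fin N) (ha : a = ⟨0, by omega⟩) (hb : b = ⟨1, by omega⟩)
    (w : Fin N → Fin N → ℝ)
    (hw : ∀ x y : Fin N, w x y =
      if x = y then 0
      else if (x = a ∧ y = b) ∨ (x = b ∧ y = a) then 0
      else 1)
    (x y : Fin N) :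
    (∀ t : ℝ, 0 < t →
      deriv (fun s : ℝ => heatKernelDeletedEdge N a b x y s) t +
        ∑ v : Fin N,
          (heatKernelDeletedEdge N a b x y t - heatKernelDeletedEdge N a b v y t) *
            w x v = 0) ∧
    heatKernelDeletedEdge N a b x y 0 = if x = y then 1 else 0 := by
  have hab : a ≠ b := by
    subst ha hb
    simp
  have hN0 : (N : ℝ) ≠ 0 := by
    have : N ≠ 0 := by omega
    exact_mod_cast this
  refine ⟨fun t _ => ?_, ?_⟩
  · have hw' : ∀ v, (heatKernelDeletedEdge N a b x y t - heatKernelDeletedEdge N a b v y t) *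
            w x v = heatKernelDeletedEdge N a b x y t - heatKernelDeletedEdge N a b v y t
          - (if v = b then (if x = a then heatKernelDeletedEdge N a b a y t
              - heatKernelDeletedEdge N a b b y t else 0) else 0)
          - (if v = a then (if x = b then heatKernelDeletedEdge N a b b y t
              - heatKernelDeletedEdge N a b a y t else 0) else 0) := by
      intro v
      rw [hw]
      by_cases h1 : x = a <;> by_cases h2 : x = b <;> by_cases h3 : v = a <;>
        by_cases h4 : v = b <;> by_cases h5 : x = v <;> simp_all
    have hs : ∑ v : Fin N,
          (heatKernelDeletedEdge N a b x y t - heatKernelDeletedEdge N a b v y t) * w x v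
        = N * heatKernelDeletedEdge N a b x y t - 1 - edgeSign N a b x *
          (heatKernelDeletedEdge N a b a y t - heatKernelDeletedEdge N a b b y t) := by
      simp only [hw', Finset.sum_sub_distrib, heatKernelDeletedEdge_sum N hN0 a b y hab,
        Finset.sum_ite_eq', edgeSign]
      by_cases h1 : x = a <;> by_cases h2 : x = b <;> simp_all
    have hd : HasDerivAt (fun s : ℝ => heatKernelDeletedEdge N a b x y s)
        (((if x = y then 1 else 0) - 1 / N) * (Real.exp (-(N : ℝ) * t) * (-(N : ℝ))) +
          edgeSign N a b x * edgeSign N a b y *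
          ((Real.exp (-(N : ℝ) * t) * (-(N : ℝ)) * (Real.exp (2 * t) - 1) +
            Real.exp (-(N : ℝ) * t) * (Real.exp (2 * t) * 2)) / 2)) t := by
      simp only [heatKernelDeletedEdge_eq N a b x y hab]
      have h1 : HasDerivAt (fun s : ℝ => Real.exp (-(N : ℝ) * s))
          (Real.exp (-(N : ℝ) * t) * (-(N : ℝ))) t := by
        simpa using ((hasDerivAt_id t).const_mul (-(N : ℝ))).exp
      have h2 : HasDerivAt (fun s : ℝ => Real.exp (2 * s)) (Real.exp (2 * t) * 2) t := by
        simpa using ((hasDerivAt_id t).const_mul (2 : ℝ)).exp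
      exact ((h1.const_mul _).const_add _).add
        (((h1.mul (h2.sub_const 1)).div_const 2).const_mul _)
    have hAB : heatKernelDeletedEdge N a b a y t - heatKernelDeletedEdge N a b b y t
        = edgeSign N a b y * (Real.exp (-(N : ℝ) * t) * Real.exp (2 * t)) := by
      rw [heatKernelDeletedEdge_eq N a b a y hab, heatKernelDeletedEdge_eq N a b b y hab]
      have e1 : edgeSign N a b a = 1 := by simp [edgeSign, hab]
      have e2 : edgeSign N a b b = -1 := by simp [edgeSign, hab.symm]
      have e3 : edgeSign N a b y = (if a = y then 1 else 0) - (if b = y then 1 else 0) := by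
        simp [edgeSign, eq_comm]
      rw [e1, e2, e3]
      ring
    rw [hd.deriv, hs, hAB, heatKernelDeletedEdge_eq N a b x y hab]
    field_simp
    ring
  · rw [heatKernelDeletedEdge_eq N a b x y hab]
    simp
end

section
/- Let G be the discrete half-line: the graph with vertex set ℤ_{≥0} and weight-1 edges between consecutive integers, so its Laplacian is Δf(0) = f(0) − f(1) and Δf(v) = 2f(v) − f(v−1) − f(v+1) for v ≥ 1. Then the function H_G(v,w;t) = e^{−2t}(I_{|v−w|}(2t) + I_{v+w+1}(2t)) satisfies Δ_v H_G(v,w;t) + ∂_t H_G(v,w;t) = 0 for all v, w ∈ ℤ_{≥0} and t > 0, and H_G(v,w;0) = 1 if v = w and 0 otherwise; i.e., H_G is the heat kernel on the discrete half-line. -/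
/-- The modified Bessel function of the first kind of integer order `n ≥ 0`:
`I_n(t) = ∑_{k=0}^∞ (t/2)^{2k+n}/(k!(k+n)!)`. -/
noncomputable def besselI (n : ℕ) (t : ℝ) : ℝ :=
  ∑' k : ℕ, (t / 2) ^ (2 * k + n) / ((k.factorial : ℝ) * ((k + n).factorial : ℝ))

/-- The heat kernel on the discrete half-line `ℤ_{≥0}`:
`H_G(v,w;t) = e^{−2t}(I_{|v−w|}(2t) + I_{v+w+1}(2t))`. -/
noncomputable def heatKernelHalfLine (v w : ℕ) (t : ℝ) : ℝ :=
  Real.exp (-2 * t) *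
    (besselI ((v : ℤ) - (w : ℤ)).natAbs (2 * t) + besselI (v + w + 1) (2 * t))

/-- The `k`-th term of the Bessel series, in the variable `y = t / 2`. -/
noncomputable def bTerm (n k : ℕ) (y : ℝ) : ℝ :=
  y ^ (2 * k + n) / ((k.factorial : ℝ) * ((k + n).factorial : ℝ))

/-- The shifted term. -/
noncomputable def bShift (n : ℕ) : ℕ → ℝ → ℝ
  | 0, _ => 0
  | k + 1, y => bTerm (n + 1) k y

/-- Majorant of the Bessel terms on a ball of radius `R`. -/
noncomputable def bMaj (n : ℕ) (R : ℝ) (k : ℕ) : ℝ := R ^ n * ((R ^ 2) ^ k / (k.factorial : ℝ))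

/-- Majorant of the shifted terms. -/
noncomputable def bMajShift (n : ℕ) (R : ℝ) : ℕ → ℝ
  | 0 => 0
  | k + 1 => bMaj (n + 1) R k

lemma bMaj_summable (n : ℕ) (R : ℝ) : Summable (bMaj n R) :=
  (Real.summable_pow_div_factorial (R ^ 2)).mul_left _

lemma bMajShift_summable (n : ℕ) (R : ℝ) : Summable (bMajShift n R) :=
  (summable_nat_add_iff 1).1 (bMaj_summable (n + 1) R)

lemma bTerm_le (n k : ℕ) {y R : ℝ} (h : |y| ≤ R) : ‖bTerm n k y‖ ≤ bMaj n R k := by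
  have hR : 0 ≤ R := (abs_nonneg y).trans h
  have e : ‖bTerm n k y‖ = |y| ^ (2 * k + n) / ((k.factorial : ℝ) * ((k + n).factorial : ℝ)) := by
    simp [bTerm]
  have e2 : bMaj n R k = R ^ (2 * k + n) / ((k.factorial : ℝ) * 1) := by
    rw [bMaj, pow_add, pow_mul]; ring
  have h1 : (1 : ℝ) ≤ ((k + n).factorial : ℝ) := by exact_mod_cast Nat.factorial_pos _
  have h2 : (0 : ℝ) < (k.factorial : ℝ) := by exact_mod_cast Nat.factorial_pos _
  rw [e, e2]
  gcongr

lemma bShift_le (n k : ℕ) {y R : ℝ} (h : |y| ≤ R) : ‖bShift n k y‖ ≤ bMajShift n R k := by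
  cases k with
  | zero => simp [bShift, bMajShift]
  | succ k => exact bTerm_le (n + 1) k h

lemma bTerm_summable (n : ℕ) (y : ℝ) : Summable (fun k => bTerm n k y) :=
  Summable.of_norm_bounded (bMaj_summable n |y|) (fun k => bTerm_le n k le_rfl)

lemma bShift_summable (n : ℕ) (y : ℝ) : Summable (fun k => bShift n k y) :=
  (summable_nat_add_iff 1).1 (bTerm_summable (n + 1) y)

lemma bShift_tsum (n : ℕ) (y : ℝ) : ∑' k, bShift n k y = ∑' k, bTerm (n + 1) k y := by
  rw [(bShift_summable n y).tsum_eq_zero_add]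
  simp [bShift]

lemma bTerm_hasDerivAt_succ (n k : ℕ) (y : ℝ) :
    HasDerivAt (bTerm (n + 1) k) (bTerm n k y + bShift (n + 1) k y) y := by
  have h := (hasDerivAt_pow (2 * k + (n + 1)) y).div_const
    ((k.factorial : ℝ) * ((k + (n + 1)).factorial : ℝ))
  refine h.congr_deriv ?_
  cases k with
  | zero =>
    have h2 : (n.factorial : ℝ) ≠ 0 := by exact_mod_cast Nat.factorial_ne_zero _
    simp [bTerm, bShift, Nat.factorial_succ]
    field_simp
  | succ k =>
    have h1 : (k.factorial : ℝ) ≠ 0 := by exact_mod_cast Nat.factorial_ne_zero _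
    have h2 : ((k + n + 1).factorial : ℝ) ≠ 0 := by exact_mod_cast Nat.factorial_ne_zero _
    have e1 : k + 1 + (n + 1) = (k + n + 1) + 1 := by ring
    have e2 : k + 1 + n = k + n + 1 := by ring
    have e3 : k + (n + 1 + 1) = (k + n + 1) + 1 := by ring
    have e4 : 2 * (k + 1) + (n + 1) - 1 = 2 * k + n + 2 := by omega
    simp only [bTerm, bShift]
    rw [e1, e2, e3, e4, Nat.factorial_succ (k + n + 1), Nat.factorial_succ k]
    have h3 : (k : ℝ) + 1 ≠ 0 := by positivity
    have h4 : (k : ℝ) + n + 1 + 1 ≠ 0 := by positivity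
    push_cast
    field_simp
    ring

lemma bTerm_hasDerivAt_zero (k : ℕ) (y : ℝ) :
    HasDerivAt (bTerm 0 k) (bShift 0 k y + bShift 0 k y) y := by
  have h := (hasDerivAt_pow (2 * k + 0) y).div_const
    ((k.factorial : ℝ) * ((k + 0).factorial : ℝ))
  refine h.congr_deriv ?_
  cases k with
  | zero => simp [bShift]
  | succ k =>
    have h1 : (k.factorial : ℝ) ≠ 0 := by exact_mod_cast Nat.factorial_ne_zero _
    have e4 : 2 * (k + 1) + 0 - 1 = 2 * k + 1 := by omega
    have h3 : (k : ℝ) + 1 ≠ 0 := by positivity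
    simp only [bTerm, bShift]
    rw [e4]
    simp only [add_zero, zero_add, Nat.factorial_succ k]
    push_cast
    field_simp
    ring

lemma bSum_hasDerivAt_succ (n : ℕ) (y : ℝ) :
    HasDerivAt (fun z => ∑' k, bTerm (n + 1) k z)
      ((∑' k, bTerm n k y) + ∑' k, bTerm (n + 2) k y) y := by
  rw [← bShift_tsum (n + 1), ← (bTerm_summable n y).tsum_add (bShift_summable (n + 1) y)]
  have hb : ∀ z ∈ Metric.ball (0 : ℝ) (|y| + 1), |z| ≤ |y| + 1 := fun z hz => by
    have := mem_ball_zero_iff.1 hz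
    exact this.le
  have hy : y ∈ Metric.ball (0 : ℝ) (|y| + 1) := by
    rw [mem_ball_zero_iff, Real.norm_eq_abs]; linarith
  exact hasDerivAt_tsum_of_isPreconnected
    ((bMaj_summable n (|y| + 1)).add (bMajShift_summable (n + 1) (|y| + 1)))
    Metric.isOpen_ball (convex_ball (0 : ℝ) _).isPreconnected
    (fun k z _ => bTerm_hasDerivAt_succ n k z)
    (fun k z hz => (norm_add_le _ _).trans
      (add_le_add (bTerm_le n k (hb z hz)) (bShift_le (n + 1) k (hb z hz))))
    hy (bTerm_summable (n + 1) y) hy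

lemma bSum_hasDerivAt_zero (y : ℝ) :
    HasDerivAt (fun z => ∑' k, bTerm 0 k z)
      ((∑' k, bTerm 1 k y) + ∑' k, bTerm 1 k y) y := by
  have e := bShift_tsum 0 y
  rw [zero_add] at e
  rw [← e, ← (bShift_summable 0 y).tsum_add (bShift_summable 0 y)]
  have hb : ∀ z ∈ Metric.ball (0 : ℝ) (|y| + 1), |z| ≤ |y| + 1 := fun z hz => by
    have := mem_ball_zero_iff.1 hz
    exact this.le
  have hy : y ∈ Metric.ball (0 : ℝ) (|y| + 1) := by
    rw [mem_ball_zero_iff, Real.norm_eq_abs]; linarith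
  exact hasDerivAt_tsum_of_isPreconnected
    ((bMajShift_summable 0 (|y| + 1)).add (bMajShift_summable 0 (|y| + 1)))
    Metric.isOpen_ball (convex_ball (0 : ℝ) _).isPreconnected
    (fun k z _ => bTerm_hasDerivAt_zero k z)
    (fun k z hz => (norm_add_le _ _).trans
      (add_le_add (bShift_le 0 k (hb z hz)) (bShift_le 0 k (hb z hz))))
    hy (bTerm_summable 0 y) hy

lemma besselI_two_mul (n : ℕ) (t : ℝ) : besselI n (2 * t) = ∑' k, bTerm n k t := by
  have e : 2 * t / 2 = t := by ring
  simp only [besselI, bTerm, e]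

/-- `d/dt I_n(2t) = I_{n-1}(2t) + I_{n+1}(2t)` for integers `n`, with `I_{-n} = I_n`. -/
lemma besselI_hasDerivAt (n : ℤ) (t : ℝ) :
    HasDerivAt (fun s => besselI n.natAbs (2 * s))
      (besselI (n - 1).natAbs (2 * t) + besselI (n + 1).natAbs (2 * t)) t := by
  simp only [besselI_two_mul]
  rcases lt_trichotomy n 0 with h | h | h
  · obtain ⟨m, hm⟩ : ∃ m : ℕ, n = -((m : ℤ) + 1) := ⟨(-n - 1).toNat, by omega⟩
    have e1 : n.natAbs = m + 1 := by omega
    have e2 : (n - 1).natAbs = m + 2 := by omega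
    have e3 : (n + 1).natAbs = m := by omega
    rw [e1, e2, e3]
    exact (bSum_hasDerivAt_succ m t).congr_deriv (add_comm _ _)
  · subst h
    exact bSum_hasDerivAt_zero t
  · obtain ⟨m, hm⟩ : ∃ m : ℕ, n = (m : ℤ) + 1 := ⟨(n - 1).toNat, by omega⟩
    have e1 : n.natAbs = m + 1 := by omega
    have e2 : (n - 1).natAbs = m := by omega
    have e3 : (n + 1).natAbs = m + 2 := by omega
    rw [e1, e2, e3]
    exact bSum_hasDerivAt_succ m t

lemma besselI_zero (n : ℕ) : besselI n 0 = if n = 0 then 1 else 0 := by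
  rw [besselI, tsum_eq_single 0]
  · by_cases h : n = 0 <;> simp [h]
  · intro k hk
    have : 2 * k + n ≠ 0 := by omega
    rw [zero_div, zero_pow this, zero_div]

lemma heatKernelHalfLine_hasDerivAt (v w : ℕ) (t : ℝ) :
    HasDerivAt (fun s => heatKernelHalfLine v w s)
      (Real.exp (-2 * t) * (besselI ((v : ℤ) - w - 1).natAbs (2 * t)
        + besselI ((v : ℤ) - w + 1).natAbs (2 * t)
        + (besselI (v + w) (2 * t) + besselI (v + w + 2) (2 * t)))
        - 2 * heatKernelHalfLine v w t) t := by
  have h1 := besselI_hasDerivAt ((v : ℤ) - w) t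
  have h2 := besselI_hasDerivAt ((v : ℤ) + w + 1) t
  have e1 : ((v : ℤ) + w + 1).natAbs = v + w + 1 := by omega
  have e2 : ((v : ℤ) + w + 1 - 1).natAbs = v + w := by omega
  have e3 : ((v : ℤ) + w + 1 + 1).natAbs = v + w + 2 := by omega
  rw [e1, e2, e3] at h2
  have h3 : HasDerivAt (fun s : ℝ => Real.exp (-2 * s)) (Real.exp (-2 * t) * (-2)) t := by
    simpa using ((hasDerivAt_id t).const_mul (-2 : ℝ)).exp
  refine (h3.mul (h1.add h2)).congr_deriv ?_
  simp only [heatKernelHalfLine, Pi.add_apply]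
  ring

/-- `heatKernelHalfLine` is the heat kernel on the discrete half-line: it satisfies
`Δ_v H_G + ∂_t H_G = 0` where `Δf(0) = f(0) − f(1)` and
`Δf(v) = 2f(v) − f(v−1) − f(v+1)` for `v ≥ 1`, together with the Dirac initial
condition. -/
theorem heatKernelHalfLine_is_heat_kernel (v w : ℕ) :
    (∀ t : ℝ, 0 < t →
      (if v = 0 then heatKernelHalfLine 0 w t - heatKernelHalfLine 1 w t
       else 2 * heatKernelHalfLine v w t - heatKernelHalfLine (v - 1) w t -
         heatKernelHalfLine (v + 1) w t) +
        deriv (fun s : ℝ => heatKernelHalfLine v w s) t = 0) ∧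
    heatKernelHalfLine v w 0 = if v = w then 1 else 0 := by
  refine ⟨fun t _ => ?_, ?_⟩
  · rw [(heatKernelHalfLine_hasDerivAt v w t).deriv]
    cases v with
    | zero =>
      have e1 : (((0 : ℕ) : ℤ) - w).natAbs = w := by omega
      have e2 : (((0 : ℕ) : ℤ) - w - 1).natAbs = w + 1 := by omega
      have e3 : (((0 : ℕ) : ℤ) - w + 1).natAbs = (((1 : ℕ) : ℤ) - w).natAbs := by omega
      have e4 : 1 + w + 1 = w + 2 := by omega
      rw [if_pos rfl]
      simp only [heatKernelHalfLine]
      rw [e1, e2, e3, e4, zero_add]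
      ring
    | succ v =>
      have e1 : (((v + 1 : ℕ) : ℤ) - w - 1).natAbs = ((v : ℤ) - w).natAbs := by omega
      have e2 : (((v + 1 : ℕ) : ℤ) - w + 1).natAbs = (((v + 1 + 1 : ℕ) : ℤ) - w).natAbs := by
        omega
      have e3 : v + 1 + w = v + w + 1 := by omega
      have e4 : v + 1 + 1 + w + 1 = v + w + 1 + 2 := by omega
      rw [if_neg (Nat.succ_ne_zero v), Nat.add_sub_cancel]
      simp only [heatKernelHalfLine]
      rw [e1, e2, e3, e4]
      ring
  · have e : (((v : ℤ) - w).natAbs = 0) ↔ v = w := by omega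
    simp only [heatKernelHalfLine, mul_zero, besselI_zero, e]
    simp
end

section
/- For all integers x ≥ 1 and y ≥ 0 and all real t ≥ 0: I_{x+y}(t) = ∑_{ℓ=0}^∞ ((−1)^ℓ/2^{ℓ+1}) (I_1^{∗ℓ} ∗ I_{x−1} ∗ I_y)(t). -/
/-- The one-variable convolution `(f ∗ g)(t) = ∫_0^t f(τ) g(t−τ) dτ`. -/
noncomputable def oneConv (f g : ℝ → ℝ) : ℝ → ℝ :=
  fun t => ∫ τ in (0:ℝ)..t, f τ * g (t - τ)

/-- `convPow f ℓ g` is the convolution `f^{∗ℓ} ∗ g`, with the convention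
`f^{∗0} ∗ g = g`. -/
noncomputable def convPow (f : ℝ → ℝ) : ℕ → (ℝ → ℝ) → (ℝ → ℝ)
  | 0, g => g
  | n + 1, g => oneConv f (convPow f n g)

open Filter Topology MeasureTheory

/-- Terms of the Bessel series. -/
noncomputable def bT (n k : ℕ) (t : ℝ) : ℝ :=
  (t / 2) ^ (2 * k + n) / ((k.factorial : ℝ) * ((k + n).factorial : ℝ))

/-- Shifted terms. -/
noncomputable def bP (n : ℕ) (k : ℕ) (t : ℝ) : ℝ :=
  match k with
  | 0 => 0
  | k + 1 => bT (n + 1) k t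

lemma besselI_eq (n : ℕ) (t : ℝ) : besselI n t = ∑' k, bT n k t := rfl

lemma bT_abs (n k : ℕ) (t : ℝ) : |bT n k t| = bT n k |t| := by
  unfold bT
  rw [abs_div, abs_pow, abs_div, abs_of_pos (show (0:ℝ) < (k.factorial : ℝ) * ((k + n).factorial : ℝ) by positivity)]
  simp

lemma bT_mono (n k : ℕ) {s t : ℝ} (hs : 0 ≤ s) (h : s ≤ t) : bT n k s ≤ bT n k t := by
  unfold bT
  gcongr

lemma bT_bound (n k : ℕ) {t : ℝ} (ht : 0 ≤ t) :
    bT n k t ≤ (t / 2) ^ n / n.factorial * (((t / 2) ^ 2) ^ k / k.factorial) := by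
  unfold bT
  rw [pow_add, pow_mul, div_mul_div_comm, mul_comm ((t / 2) ^ n), mul_comm (n.factorial : ℝ)]
  gcongr
  omega

lemma bT_summable_nonneg (n : ℕ) {t : ℝ} (ht : 0 ≤ t) : Summable (fun k => bT n k t) := by
  refine Summable.of_nonneg_of_le (fun k => ?_) (fun k => bT_bound n k ht)
    ((Real.summable_pow_div_factorial ((t / 2) ^ 2)).mul_left _)
  unfold bT; positivity

lemma bT_summable (n : ℕ) (t : ℝ) : Summable (fun k => bT n k t) := by
  apply Summable.of_abs
  simp only [bT_abs]
  exact bT_summable_nonneg n (abs_nonneg t)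

lemma besselI_bound (n : ℕ) {t R : ℝ} (h : |t| ≤ R) :
    |besselI n t| ≤ (R / 2) ^ n / n.factorial * Real.exp ((R / 2) ^ 2) := by
  have hR : 0 ≤ R := (abs_nonneg t).trans h
  rw [besselI_eq]
  have hs := ((Real.summable_pow_div_factorial ((R / 2) ^ 2)).mul_left ((R / 2) ^ n / (n.factorial : ℝ)))
  have h1 := tsum_of_norm_bounded (f := fun k => bT n k t) hs.hasSum (fun k => by
    rw [Real.norm_eq_abs, bT_abs]
    exact (bT_mono n k (abs_nonneg t) h).trans (bT_bound n k hR))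
  rw [tsum_mul_left] at h1
  rw [Real.exp_eq_exp_ℝ, NormedSpace.exp_eq_tsum_div]
  exact h1

lemma bP_abs (n k : ℕ) (t : ℝ) : |bP n k t| = bP n k |t| := by
  cases k with
  | zero => simp [bP]
  | succ k => exact bT_abs _ _ _

lemma bP_mono (n k : ℕ) {s t : ℝ} (hs : 0 ≤ s) (h : s ≤ t) : bP n k s ≤ bP n k t := by
  cases k with
  | zero => simp [bP]
  | succ k => exact bT_mono _ _ hs h

lemma bP_hasSum (n : ℕ) (t : ℝ) : HasSum (fun k => bP n k t) (besselI (n + 1) t) := by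
  rw [← hasSum_nat_add_iff' 1]
  simpa [bP, besselI_eq] using (bT_summable (n + 1) t).hasSum

lemma bT_deriv_zero (k : ℕ) (t : ℝ) : HasDerivAt (bT 0 k) (bP 0 k t) t := by
  have h := (((hasDerivAt_id t).div_const 2).pow (2 * k + 0)).div_const
    ((k.factorial : ℝ) * ((k + 0).factorial : ℝ))
  refine h.congr_deriv ?_
  cases k with
  | zero => simp [bP]
  | succ k =>
    simp only [bP, bT, id, add_zero, zero_add, Nat.factorial_succ]
    rw [show 2 * (k + 1) - 1 = 2 * k + 1 by omega]
    push_cast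
    field_simp

lemma bT_deriv_succ (n k : ℕ) (t : ℝ) :
    HasDerivAt (bT (n + 1) k) ((bT n k t + bP (n + 1) k t) / 2) t := by
  have h := (((hasDerivAt_id t).div_const 2).pow (2 * k + (n + 1))).div_const
    ((k.factorial : ℝ) * ((k + (n + 1)).factorial : ℝ))
  refine h.congr_deriv ?_
  cases k with
  | zero =>
    simp only [bP, bT, id, add_zero, zero_add, Nat.factorial_succ, mul_zero]
    rw [show n + 1 - 1 = n by omega]
    push_cast
    field_simp
  | succ k =>
    simp only [bP, bT, id]
    rw [show 2 * (k + 1) + (n + 1) - 1 = 2 * k + n + 2 by omega,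
      show 2 * (k + 1) + n = 2 * k + n + 2 by omega,
      show 2 * k + (n + 1 + 1) = 2 * k + n + 2 by omega,
      show k + 1 + (n + 1) = k + n + 1 + 1 by omega,
      show k + (n + 1 + 1) = k + n + 1 + 1 by omega,
      show k + 1 + n = k + n + 1 by omega]
    simp only [Nat.factorial_succ]
    push_cast
    field_simp
    ring

lemma besselI_deriv_zero (t : ℝ) : HasDerivAt (besselI 0) (besselI 1 t) t := by
  have h := hasDerivAt_tsum_of_isPreconnected (g := bT 0) (g' := bP 0)
    (u := fun k => bP 0 k (|t| + 1)) (t := Metric.ball 0 (|t| + 1)) (y₀ := t) (y := t)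
    (bP_hasSum 0 _).summable Metric.isOpen_ball (convex_ball _ _).isPreconnected
    (fun k y _ => bT_deriv_zero k y)
    (fun k y hy => by
      rw [Real.norm_eq_abs, bP_abs]
      rw [mem_ball_zero_iff] at hy
      exact bP_mono _ _ (abs_nonneg _) hy.le)
    (by simp) (bT_summable 0 t) (by simp)
  rwa [(bP_hasSum 0 t).tsum_eq] at h

lemma besselI_deriv_succ (n : ℕ) (t : ℝ) :
    HasDerivAt (besselI (n + 1)) ((besselI n t + besselI (n + 2) t) / 2) t := by
  have hS : ∀ s, HasSum (fun k => (bT n k s + bP (n + 1) k s) / 2)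
      ((besselI n s + besselI (n + 2) s) / 2) := fun s =>
    ((bT_summable n s).hasSum.add (bP_hasSum (n + 1) s)).div_const 2
  have h := hasDerivAt_tsum_of_isPreconnected (g := bT (n + 1))
    (g' := fun k s => (bT n k s + bP (n + 1) k s) / 2)
    (u := fun k => (bT n k (|t| + 1) + bP (n + 1) k (|t| + 1)) / 2)
    (t := Metric.ball 0 (|t| + 1)) (y₀ := t) (y := t)
    (hS _).summable Metric.isOpen_ball (convex_ball _ _).isPreconnected
    (fun k y _ => bT_deriv_succ n k y)
    (fun k y hy => by
      rw [mem_ball_zero_iff] at hy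
      rw [Real.norm_eq_abs, abs_div, abs_two]
      have h1 := abs_add_le (bT n k y) (bP (n + 1) k y)
      rw [bT_abs, bP_abs] at h1
      have h2 := bP_mono (n + 1) k (abs_nonneg _) hy.le
      have h3 := bT_mono n k (abs_nonneg _) hy.le
      linarith)
    (by simp) (bT_summable _ t) (by simp)
  rwa [(hS t).tsum_eq] at h

lemma besselI_cont (n : ℕ) : Continuous (besselI n) := by
  cases n with
  | zero => exact continuous_iff_continuousAt.2 fun t => (besselI_deriv_zero t).continuousAt
  | succ n => exact continuous_iff_continuousAt.2 fun t => (besselI_deriv_succ n t).continuousAt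

lemma besselI_succ_zero (n : ℕ) : besselI (n + 1) 0 = 0 := by
  simp [besselI]

lemma besselI_zero_zero : besselI 0 0 = 1 := by
  rw [besselI, tsum_eq_single 0]
  · simp
  · intro k hk; simp [hk]

lemma conv_ii (a b : ℕ) (t : ℝ) :
    IntervalIntegrable (fun τ => besselI a τ * besselI b (t - τ)) volume 0 t := by
  apply Continuous.intervalIntegrable
  exact (besselI_cont a).mul ((besselI_cont b).comp (continuous_const.sub continuous_id))

lemma conv_step (a b : ℕ) (t : ℝ) :
    oneConv (besselI (a + 2)) (besselI (b + 1)) t - oneConv (besselI (a + 1)) (besselI (b + 2)) t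
    = oneConv (besselI (a + 1)) (besselI b) t - oneConv (besselI a) (besselI (b + 1)) t := by
  have h := intervalIntegral.integral_eq_sub_of_hasDerivAt (a := 0) (b := t)
    (f := fun τ => besselI (a + 1) τ * besselI (b + 1) (t - τ))
    (f' := fun τ => (1 / 2 : ℝ) * (besselI a τ * besselI (b + 1) (t - τ)
        + besselI (a + 2) τ * besselI (b + 1) (t - τ)
        - besselI (a + 1) τ * besselI b (t - τ)
        - besselI (a + 1) τ * besselI (b + 2) (t - τ)))
    (fun τ _ => by
      have h1 := (besselI_deriv_succ b (t - τ)).comp τ ((hasDerivAt_id τ).const_sub t)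
      refine ((besselI_deriv_succ a τ).mul h1).congr_deriv ?_
      simp only [Function.comp]
      ring)
    (((((conv_ii _ _ t).add (conv_ii _ _ t)).sub (conv_ii _ _ t)).sub (conv_ii _ _ t)).const_mul _)
  rw [intervalIntegral.integral_const_mul, intervalIntegral.integral_sub
    (((conv_ii _ _ t).add (conv_ii _ _ t)).sub (conv_ii _ _ t)) (conv_ii _ _ t),
    intervalIntegral.integral_sub ((conv_ii _ _ t).add (conv_ii _ _ t)) (conv_ii _ _ t),
    intervalIntegral.integral_add (conv_ii _ _ t) (conv_ii _ _ t)] at h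
  simp only [sub_self, besselI_succ_zero, mul_zero, zero_mul] at h
  simp only [oneConv]
  linarith

lemma conv_zero (b : ℕ) (t : ℝ) :
    - besselI (b + 1) t = oneConv (besselI 1) (besselI (b + 1)) t
      - (oneConv (besselI 0) (besselI b) t + oneConv (besselI 0) (besselI (b + 2)) t) / 2 := by
  have h := intervalIntegral.integral_eq_sub_of_hasDerivAt (a := 0) (b := t)
    (f := fun τ => besselI 0 τ * besselI (b + 1) (t - τ))
    (f' := fun τ => besselI 1 τ * besselI (b + 1) (t - τ)
        - (1 / 2 : ℝ) * (besselI 0 τ * besselI b (t - τ)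
        + besselI 0 τ * besselI (b + 2) (t - τ)))
    (fun τ _ => by
      have h1 := (besselI_deriv_succ b (t - τ)).comp τ ((hasDerivAt_id τ).const_sub t)
      refine ((besselI_deriv_zero τ).mul h1).congr_deriv ?_
      simp only [Function.comp]
      ring)
    ((conv_ii _ _ t).sub (((conv_ii _ _ t).add (conv_ii _ _ t)).const_mul _))
  rw [intervalIntegral.integral_sub (conv_ii _ _ t)
      (((conv_ii _ _ t).add (conv_ii _ _ t)).const_mul _),
    intervalIntegral.integral_const_mul,
    intervalIntegral.integral_add (conv_ii _ _ t) (conv_ii _ _ t)] at h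
  simp only [sub_self, sub_zero, besselI_succ_zero, besselI_zero_zero, mul_zero, one_mul] at h
  simp only [oneConv]
  linarith

lemma conv_tendsto (a b : ℕ) (t : ℝ) :
    Tendsto (fun k => oneConv (besselI (a + k)) (besselI (b + k)) t) atTop (𝓝 0) := by
  set c : ℕ → ℝ := fun n => (|t| / 2) ^ n / n.factorial * Real.exp ((|t| / 2) ^ 2) with hc
  have hc0 : Tendsto c atTop (𝓝 0) := by
    have := (FloorSemiring.tendsto_pow_div_factorial_atTop (|t| / 2)).mul_const
      (Real.exp ((|t| / 2) ^ 2))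
    simpa using this
  have hca : Tendsto (fun k => c (a + k)) atTop (𝓝 0) := by
    have := (tendsto_add_atTop_iff_nat a).2 hc0
    simpa [add_comm] using this
  have hcb : Tendsto (fun k => c (b + k)) atTop (𝓝 0) := by
    have := (tendsto_add_atTop_iff_nat b).2 hc0
    simpa [add_comm] using this
  have hlim : Tendsto (fun k => c (a + k) * c (b + k) * |t - 0|) atTop (𝓝 0) := by
    simpa using (hca.mul hcb).mul_const |t - 0|
  refine squeeze_zero_norm (fun k => ?_) hlim
  refine intervalIntegral.norm_integral_le_of_norm_le_const fun τ hτ => ?_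
  have h1 : |τ| ≤ |t| ∧ |t - τ| ≤ |t| := by
    rcases le_total 0 t with h | h
    · rw [Set.uIoc_of_le h] at hτ
      rw [abs_of_nonneg h, abs_of_nonneg hτ.1.le, abs_of_nonneg (sub_nonneg.2 hτ.2)]
      exact ⟨hτ.2, by linarith [hτ.1]⟩
    · rw [Set.uIoc_of_ge h] at hτ
      rw [abs_of_nonpos h, abs_of_nonpos hτ.2, abs_of_nonpos (by linarith [hτ.1])]
      exact ⟨by linarith [hτ.1], by linarith [hτ.2]⟩
  rw [norm_mul]
  exact mul_le_mul (besselI_bound _ h1.1) (besselI_bound _ h1.2) (norm_nonneg _) (by positivity)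

lemma conv_shift (a b : ℕ) (t : ℝ) :
    oneConv (besselI (a + 1)) (besselI b) t = oneConv (besselI a) (besselI (b + 1)) t := by
  have h : ∀ k : ℕ, oneConv (besselI (a + 1 + k)) (besselI (b + k)) t
      - oneConv (besselI (a + k)) (besselI (b + 1 + k)) t
      = oneConv (besselI (a + 1)) (besselI b) t - oneConv (besselI a) (besselI (b + 1)) t := by
    intro k
    induction k with
    | zero => rfl
    | succ k ih =>
      rw [← ih, show a + 1 + (k + 1) = (a + k) + 2 by omega, show b + (k + 1) = b + k + 1 by omega,
        show a + (k + 1) = a + k + 1 by omega, show b + 1 + (k + 1) = b + k + 2 by omega,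
        show a + 1 + k = a + k + 1 by omega, show b + 1 + k = b + k + 1 by omega]
      exact conv_step _ _ _
  have h2 := (conv_tendsto (a + 1) b t).sub (conv_tendsto a (b + 1) t)
  simp only [h, sub_zero] at h2
  exact sub_eq_zero.1 (tendsto_nhds_unique tendsto_const_nhds h2)

lemma conv_all (a b : ℕ) (t : ℝ) :
    oneConv (besselI a) (besselI b) t = oneConv (besselI 0) (besselI (a + b)) t := by
  induction a generalizing b with
  | zero => rw [zero_add]
  | succ a ih => rw [conv_shift, ih, show a + (b + 1) = a + 1 + b by omega]

lemma conv_key (a b : ℕ) :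
    oneConv (besselI a) (besselI b)
      = fun t => 2 * besselI (a + b + 1) t + oneConv (besselI 1) (besselI (a + b + 1)) t := by
  funext t
  have h := conv_zero (a + b) t
  rw [← conv_shift 0 (a + b + 1)] at h
  rw [conv_all]
  simp only [zero_add] at h
  linarith

lemma oneConv_cont {f g : ℝ → ℝ} (hf : Continuous f) (hg : Continuous g) :
    Continuous (oneConv f g) := by
  unfold oneConv
  apply intervalIntegral.continuous_parametric_intervalIntegral_of_continuous
  · fun_prop
  · fun_prop

lemma convPow_cont {f g : ℝ → ℝ} (hf : Continuous f) (hg : Continuous g) (n : ℕ) :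
    Continuous (convPow f n g) := by
  induction n with
  | zero => exact hg
  | succ n ih => exact oneConv_cont hf ih

lemma convPow_lin {f g h : ℝ → ℝ} (hf : Continuous f) (hg : Continuous g) (hh : Continuous h)
    (c : ℝ) (n : ℕ) : convPow f n (fun t => c * g t + h t)
      = fun t => c * convPow f n g t + convPow f n h t := by
  induction n with
  | zero => rfl
  | succ n ih =>
    funext t
    simp only [convPow, ih, oneConv]
    have h1 := convPow_cont hf hg n
    have h2 := convPow_cont hf hh n
    rw [← intervalIntegral.integral_const_mul, ← intervalIntegral.integral_add]
    · congr 1; funext τ; ring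
    · exact Continuous.intervalIntegrable (by fun_prop) _ _
    · exact Continuous.intervalIntegrable (by fun_prop) _ _

lemma convPow_succ' (f g : ℝ → ℝ) (n : ℕ) : convPow f n (oneConv f g) = convPow f (n + 1) g := by
  induction n with
  | zero => rfl
  | succ n ih => rw [convPow, ih]; rfl

lemma convPow_bound {f g : ℝ → ℝ} {T A B : ℝ} (hf : Continuous f) (hg : Continuous g)
    (hA : ∀ s ∈ Set.Icc 0 T, |f s| ≤ A) (hB : ∀ s ∈ Set.Icc 0 T, |g s| ≤ B) (n : ℕ) :
    ∀ s ∈ Set.Icc 0 T, |convPow f n g s| ≤ B * ((A * s) ^ n / n.factorial) := by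
  induction n with
  | zero => intro s hs; simpa [convPow] using hB s hs
  | succ n ih =>
    intro s hs
    have hA0 : 0 ≤ A := (abs_nonneg _).trans (hA s hs)
    have hB0 : 0 ≤ B := (abs_nonneg _).trans (hB s hs)
    have h1 : ‖∫ τ in (0:ℝ)..s, f τ * convPow f n g (s - τ)‖
        ≤ ∫ τ in (0:ℝ)..s, A * (B * ((A * (s - τ)) ^ n / n.factorial)) := by
      apply intervalIntegral.norm_integral_le_of_norm_le hs.1
      · refine Eventually.of_forall fun τ hτ => ?_
        rw [norm_mul]
        refine mul_le_mul (hA τ ⟨hτ.1.le, hτ.2.trans hs.2⟩)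
          (ih (s - τ) ⟨by linarith [hτ.2], by linarith [hτ.1, hs.2]⟩) (norm_nonneg _) hA0
      · exact Continuous.intervalIntegrable (by fun_prop) _ _
    refine h1.trans (le_of_eq ?_)
    rw [intervalIntegral.integral_comp_sub_left
      (fun τ => A * (B * ((A * τ) ^ n / n.factorial))) s]
    simp only [mul_pow, mul_div_assoc, intervalIntegral.integral_const_mul, sub_self, sub_zero,
      intervalIntegral.integral_div, integral_pow, Nat.factorial_succ]
    push_cast
    field_simp
    simp only [ne_eq, Nat.add_eq_zero_iff, one_ne_zero, and_false, not_false_eq_true, zero_pow, sub_zero]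
    ring

/-- The `I`-Bessel identity obtained from the parametrix construction of the Dirichlet
heat kernel on the discrete half-line:
`I_{x+y}(t) = ∑_{ℓ=0}^∞ ((−1)^ℓ/2^{ℓ+1}) (I_1^{∗ℓ} ∗ I_{x−1} ∗ I_y)(t)`
for all integers `x ≥ 1`, `y ≥ 0` and real `t ≥ 0`. -/
theorem besselI_parametrix_identity (x y : ℕ) (hx : 1 ≤ x) (t : ℝ) (ht : 0 ≤ t) :
    besselI (x + y) t =
      ∑' ℓ : ℕ, (-1 : ℝ) ^ ℓ / 2 ^ (ℓ + 1) *
        convPow (besselI 1) ℓ (oneConv (besselI (x - 1)) (besselI y)) t := by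
  have hN : x - 1 + y + 1 = x + y := by omega
  rw [conv_key, hN]
  simp only [convPow_lin (besselI_cont 1) (besselI_cont (x + y))
    (oneConv_cont (besselI_cont 1) (besselI_cont (x + y))), convPow_succ']
  set u : ℕ → ℝ := fun ℓ => convPow (besselI 1) ℓ (besselI (x + y)) t with hu
  set v : ℕ → ℝ := fun ℓ => (-1 / 2 : ℝ) ^ ℓ * u ℓ with hv
  have hvs : Summable v := by
    obtain ⟨A, hA⟩ := (isCompact_Icc (a := (0:ℝ)) (b := t)).exists_bound_of_continuousOn
      (besselI_cont 1).continuousOn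
    obtain ⟨B, hB⟩ := (isCompact_Icc (a := (0:ℝ)) (b := t)).exists_bound_of_continuousOn
      (besselI_cont (x + y)).continuousOn
    refine Summable.of_norm_bounded ((Real.summable_pow_div_factorial (A * t)).mul_left B)
      fun ℓ => ?_
    have h1 := convPow_bound (besselI_cont 1) (besselI_cont (x + y)) hA hB ℓ t ⟨ht, le_rfl⟩
    refine le_trans ?_ h1
    rw [hv, norm_mul]
    refine mul_le_of_le_one_left (norm_nonneg _) ?_
    rw [norm_pow]
    exact pow_le_one₀ (norm_nonneg _) (by norm_num [abs_div])
  have hs1 := hvs.hasSum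
  have hs2 := (hasSum_nat_add_iff' 1).2 hs1
  have hs := hs1.sub hs2
  have h0 : v 0 = besselI (x + y) t := by simp [hv, hu, convPow]
  rw [Finset.sum_range_one, sub_sub_cancel, h0] at hs
  rw [← hs.tsum_eq]
  congr 1
  funext ℓ
  simp only [hv, hu, div_pow, pow_succ]
  field_simp
  ring
end

section
/- For every integer y ≥ 1 and every real t ≥ 0: ∫_0^t (I_1(2(t−τ)) I_{y−1}(2τ) − I_0(2(t−τ)) I_y(2τ)) dτ = 0. -/
open MeasureTheory intervalIntegral Set

/-- Derivative of a finite convolution, placing the derivative on the second factor. -/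
theorem conv_hasDeriv (g h h' : ℝ → ℝ) (hg : Continuous g) (hh : ∀ x, HasDerivAt h (h' x) x)
    (hh' : Continuous h') (h0 : h 0 = 0) (T t : ℝ) (ht : t ∈ Icc 0 T) :
    HasDerivWithinAt (fun t => ∫ τ in (0:ℝ)..t, g (t - τ) * h τ)
      (∫ τ in (0:ℝ)..t, g (t - τ) * h' τ) (Icc 0 T) t := by
  have hc : Continuous h := continuous_iff_continuousAt.2 fun x => (hh x).continuousAt
  have hsw : ∀ (k : ℝ → ℝ) (t : ℝ), ∫ τ in (0:ℝ)..t, g (t - τ) * k τ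
      = ∫ τ in (0:ℝ)..t, g τ * k (t - τ) := by
    intro k t
    have := intervalIntegral.integral_comp_sub_left (a := 0) (b := t)
      (fun τ => g τ * k (t - τ)) t
    simpa using this
  simp only [hsw]
  have h0T : 0 ≤ T := ht.1.trans ht.2
  obtain ⟨K, hK⟩ := (isCompact_Icc (a := -(T+1)) (b := T+1)).exists_bound_of_continuousOn
    hh'.continuousOn
  have hKnn : 0 ≤ K := (norm_nonneg _).trans (hK 0 ⟨by linarith, by linarith⟩)
  have hlip : LipschitzOnWith (Real.nnabs K) h (Icc (-(T+1)) (T+1)) := by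
    apply (convex_Icc _ _).lipschitzOnWith_of_nnnorm_hasDerivWithin_le
      (fun x _ => (hh x).hasDerivWithinAt)
    intro x hx
    rw [← NNReal.coe_le_coe]
    simpa [abs_of_nonneg hKnn] using hK x hx
  obtain ⟨G, hG⟩ := (isCompact_Icc (a := 0) (b := T)).exists_bound_of_continuousOn
    hg.continuousOn
  have hGnn : 0 ≤ G := (norm_nonneg _).trans (hG 0 ⟨le_rfl, h0T⟩)
  have key := (hasDerivAt_integral_of_dominated_loc_of_lip (μ := volume) (a := 0) (b := T)
    (F := fun x τ => g τ * h (max (x - τ) 0))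
    (F' := fun τ => g τ * (if 0 < t - τ then h' (t - τ) else 0))
    (x₀ := t) (s := Metric.ball t 1) (bound := fun _ => G * K)
    (Metric.ball_mem_nhds t one_pos) ?_ ?_ ?_ ?_ ?_ ?_).2
  · have e1 : ∀ x ∈ Icc 0 T, ∫ τ in (0:ℝ)..x, g τ * h (x - τ)
        = ∫ τ in (0:ℝ)..T, g τ * h (max (x - τ) 0) := by
      intro x hx
      have hcc : Continuous fun τ => g τ * h (max (x - τ) 0) := by fun_prop
      rw [← integral_add_adjacent_intervals (b := x) (hcc.intervalIntegrable _ _)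
        (hcc.intervalIntegrable _ _)]
      have : ∫ τ in x..T, g τ * h (max (x - τ) 0) = ∫ τ in x..T, (0:ℝ) := by
        apply integral_congr
        intro τ hτ
        rw [uIcc_of_le hx.2] at hτ
        have : max (x - τ) 0 = 0 := max_eq_right (by linarith [hτ.1])
        simp [this, h0]
      rw [this]
      simp only [intervalIntegral.integral_zero, add_zero]
      apply integral_congr
      intro τ hτ
      rw [uIcc_of_le hx.1] at hτ
      have : max (x - τ) 0 = x - τ := max_eq_left (by linarith [hτ.2])
      simp [this]
    have e2 : ∫ τ in (0:ℝ)..t, g τ * h' (t - τ)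
        = ∫ τ in (0:ℝ)..T, g τ * (if 0 < t - τ then h' (t - τ) else 0) := by
      rw [integral_of_le ht.1, integral_of_le h0T, integral_Ioc_eq_integral_Ioo,
        ← MeasureTheory.integral_indicator measurableSet_Ioo, ← MeasureTheory.integral_indicator measurableSet_Ioc]
      congr 1
      ext τ
      have := ht.2
      by_cases h1 : 0 < τ <;> by_cases h2 : τ < t <;> simp [indicator, h1, h2]
      intro h3; linarith
    rw [e2]
    exact key.hasDerivWithinAt.congr e1 (e1 t ht)
  · refine Filter.Eventually.of_forall fun x => ?_
    have hcc : Continuous fun τ => g τ * h (max (x - τ) 0) := by fun_prop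
    exact hcc.aestronglyMeasurable
  · have hcc : Continuous fun τ => g τ * h (max (t - τ) 0) := by fun_prop
    exact hcc.intervalIntegrable _ _
  · apply Measurable.aestronglyMeasurable
    refine hg.measurable.mul (Measurable.ite ?_ (by fun_prop) measurable_const)
    exact measurableSet_lt measurable_const (by fun_prop)
  · refine Filter.Eventually.of_forall fun τ hτ => ?_
    rw [uIoc_of_le h0T] at hτ
    have hm : ∀ x ∈ Metric.ball t 1, max (x - τ) 0 ∈ Icc (-(T+1)) (T+1) := by
      intro x hx
      rw [Metric.mem_ball, Real.dist_eq, abs_lt] at hx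
      have h1 := ht.2
      have h2 := hτ.1
      constructor
      · exact le_trans (by linarith) (le_max_right _ _)
      · apply max_le <;> linarith
    apply LipschitzOnWith.of_dist_le_mul
    intro x hx y hy
    have h1 := hlip.dist_le_mul _ (hm x hx) _ (hm y hy)
    have h2 : |max (x - τ) 0 - max (y - τ) 0| ≤ |x - y| := by
      have := abs_max_sub_max_le_abs (x - τ) (y - τ) 0
      simpa using this
    have h3 := hG τ ⟨hτ.1.le, hτ.2⟩
    simp only [Real.dist_eq, Real.coe_nnabs, abs_of_nonneg hKnn, Real.norm_eq_abs] at *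
    rw [← mul_sub, abs_mul, abs_of_nonneg (mul_nonneg hGnn hKnn), mul_assoc]
    apply mul_le_mul h3 (h1.trans (by gcongr)) (abs_nonneg _) hGnn
  · simp
  · have : ∀ᵐ τ : ℝ, τ ≠ t := by simp [ae_iff]
    filter_upwards [this] with τ hne _
    apply HasDerivAt.const_mul
    rcases lt_or_gt_of_ne hne with hlt | hgt
    · rw [if_pos (by linarith)]
      have hd : HasDerivAt (fun x => h (x - τ)) (h' (t - τ)) t :=
        (hh (t - τ)).comp_sub_const t τ
      apply hd.congr_of_eventuallyEq
      filter_upwards [lt_mem_nhds hlt] with x hx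
      rw [max_eq_left (by linarith)]
    · rw [if_neg (by linarith)]
      apply (hasDerivAt_const t (h 0)).congr_of_eventuallyEq
      filter_upwards [gt_mem_nhds hgt] with x hx
      rw [max_eq_right (by linarith)]

/-- exponential terms -/
noncomputable def ep (k : ℕ) (x : ℝ) : ℝ := x ^ k / (k.factorial : ℝ)

noncomputable def dep : ℕ → ℝ → ℝ
  | 0, _ => 0
  | k + 1, x => ep k x

theorem ep_hasDeriv (k : ℕ) (x : ℝ) : HasDerivAt (ep k) (dep k x) x := by
  cases k with
  | zero =>
    have : ep 0 = fun _ => (1:ℝ) := by ext; simp [ep]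
    rw [this]; exact hasDerivAt_const _ _
  | succ k =>
    have := (hasDerivAt_pow (k+1) x).div_const ((k+1).factorial : ℝ)
    refine this.congr_deriv ?_
    simp only [dep, ep, Nat.factorial_succ, Nat.add_sub_cancel]
    push_cast
    have : (k.factorial : ℝ) ≠ 0 := by positivity
    field_simp

theorem ep_summable (x : ℝ) : Summable fun k => ep k x := Real.summable_pow_div_factorial x

theorem ep_nonneg (k : ℕ) {x : ℝ} (hx : 0 ≤ x) : 0 ≤ ep k x := by unfold ep; positivity

theorem dep_nonneg (k : ℕ) {x : ℝ} (hx : 0 ≤ x) : 0 ≤ dep k x := by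
  cases k
  · simp [dep]
  · exact ep_nonneg _ hx

theorem dep_summable (x : ℝ) : Summable fun k => dep k x :=
  (summable_nat_add_iff 1).1 (ep_summable x)

theorem ep_le_exp (k : ℕ) {x : ℝ} (hx : 0 ≤ x) : ep k x ≤ Real.exp x :=
  Real.pow_div_factorial_le_exp x hx k

theorem ep_abs_le (k : ℕ) {x R : ℝ} (hx : |x| ≤ R) : |ep k x| ≤ ep k R := by
  unfold ep
  rw [abs_div, abs_pow, abs_of_nonneg (a := (k.factorial : ℝ)) (by positivity)]
  gcongr

theorem dep_abs_le (k : ℕ) {x R : ℝ} (hx : |x| ≤ R) : |dep k x| ≤ dep k R := by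
  cases k
  · simp [dep]
  · exact ep_abs_le _ hx

theorem dep_le_exp (k : ℕ) {x : ℝ} (hx : 0 ≤ x) : dep k x ≤ Real.exp x := by
  cases k
  · simpa [dep] using (Real.exp_pos x).le
  · exact ep_le_exp _ hx

noncomputable def fB (n : ℕ) (x : ℝ) : ℝ := ∑' k : ℕ, ep k x * ep (k + n) x

theorem besselI_eq_s19 (n : ℕ) (x : ℝ) : besselI n (2 * x) = fB n x := by
  unfold besselI fB ep
  congr 1; ext k
  rw [mul_div_cancel_left₀ _ (two_ne_zero), div_mul_div_comm, ← pow_add]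
  congr 2; ring

theorem prod_summable (n : ℕ) (x : ℝ) : Summable fun k => ep k x * ep (k + n) x := by
  apply Summable.of_norm_bounded ((ep_summable |x|).mul_right (Real.exp |x|))
  intro k
  rw [Real.norm_eq_abs, abs_mul]
  exact mul_le_mul (ep_abs_le _ le_rfl) ((ep_abs_le _ le_rfl).trans (ep_le_exp _ (abs_nonneg _)))
    (abs_nonneg _) (ep_nonneg _ (abs_nonneg _))

theorem fB_abs_le (n : ℕ) {x R : ℝ} (hx : |x| ≤ R) : |fB n x| ≤ Real.exp R * Real.exp R := by
  have hR : 0 ≤ R := (abs_nonneg _).trans hx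
  have hs : HasSum (fun k => ep k R * Real.exp R) (Real.exp R * Real.exp R) := by
    apply HasSum.mul_right
    have := NormedSpace.expSeries_div_hasSum_exp R
    rw [← Real.exp_eq_exp_ℝ] at this
    exact this
  rw [← Real.norm_eq_abs]
  unfold fB
  apply tsum_of_norm_bounded hs
  intro k
  rw [Real.norm_eq_abs, abs_mul]
  exact mul_le_mul (ep_abs_le _ hx) ((ep_abs_le _ hx).trans (ep_le_exp _ hR))
    (abs_nonneg _) (ep_nonneg _ hR)

theorem term_bound (n k : ℕ) {x R : ℝ} (hx : |x| ≤ R) :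
    ‖dep k x * ep (k + n) x + ep k x * dep (k + n) x‖
      ≤ dep k R * Real.exp R + ep k R * Real.exp R := by
  have hR : 0 ≤ R := (abs_nonneg _).trans hx
  refine (norm_add_le _ _).trans (add_le_add ?_ ?_)
  · rw [Real.norm_eq_abs, abs_mul]
    exact mul_le_mul (dep_abs_le _ hx) ((ep_abs_le _ hx).trans (ep_le_exp _ hR))
      (abs_nonneg _) (dep_nonneg _ hR)
  · rw [Real.norm_eq_abs, abs_mul]
    exact mul_le_mul (ep_abs_le _ hx) ((dep_abs_le _ hx).trans (dep_le_exp _ hR))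
      (abs_nonneg _) (ep_nonneg _ hR)

theorem fB_hasDeriv_aux (n : ℕ) (x : ℝ) :
    HasDerivAt (fB n) (∑' k : ℕ, (dep k x * ep (k + n) x + ep k x * dep (k + n) x)) x := by
  have hR : ∀ y ∈ Metric.ball (0:ℝ) (|x| + 1), |y| ≤ |x| + 1 := by
    intro y hy; simpa using (Metric.mem_ball.1 hy).le
  exact hasDerivAt_tsum_of_isPreconnected (t := Metric.ball (0:ℝ) (|x| + 1))
    (((dep_summable (|x|+1)).mul_right (Real.exp (|x|+1))).add
      ((ep_summable (|x|+1)).mul_right (Real.exp (|x|+1)))) Metric.isOpen_ball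
    (convex_ball _ _).isPreconnected
    (fun k y _ => (ep_hasDeriv k y).mul (ep_hasDeriv (k+n) y))
    (fun k y hy => term_bound n k (hR y hy))
    (y₀ := x) (by simp) (prod_summable n x) (by simp)

theorem fB_hasDeriv (n : ℕ) (x : ℝ) :
    HasDerivAt (fB (n + 1)) (fB n x + fB (n + 2) x) x := by
  convert fB_hasDeriv_aux (n + 1) x using 1
  have h1 : HasSum (fun k => ep k x * dep (k + (n + 1)) x) (fB n x) :=
    (prod_summable n x).hasSum
  have h2 : HasSum (fun k => dep k x * ep (k + (n + 1)) x) (fB (n + 2) x) := by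
    rw [← hasSum_nat_add_iff' 1]
    simp only [Finset.range_one, Finset.sum_singleton, dep, zero_mul, sub_zero]
    have e : ∀ k, k + 1 + (n + 1) = k + (n + 2) := fun k => by ring
    simp only [e]
    exact (prod_summable (n + 2) x).hasSum
  rw [(h2.add h1).tsum_eq, add_comm]

theorem fB_cont (n : ℕ) : Continuous (fB n) :=
  continuous_iff_continuousAt.2 fun x => (fB_hasDeriv_aux n x).continuousAt

theorem fB_zero (n : ℕ) : fB (n + 1) 0 = 0 := by
  unfold fB ep
  simp

/-- `W n` is the convolution expression of the theorem with `y = n + 1`. -/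
noncomputable def W (n : ℕ) (t : ℝ) : ℝ :=
  (∫ τ in (0:ℝ)..t, fB 1 (t - τ) * fB n τ) - ∫ τ in (0:ℝ)..t, fB 0 (t - τ) * fB (n + 1) τ

theorem W_zero (t : ℝ) : W 0 t = 0 := by
  unfold W
  have := intervalIntegral.integral_comp_sub_left (a := 0) (b := t)
      (fun τ => fB 1 τ * fB 0 (t - τ)) t
  simp only [sub_self, sub_zero, sub_sub_cancel] at this
  rw [this, sub_eq_zero]
  congr 1; ext τ; rw [mul_comm]

theorem W_hasDeriv (n : ℕ) {T t : ℝ} (ht : t ∈ Icc 0 T) :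
    HasDerivWithinAt (W (n + 1)) (W n t + W (n + 2) t) (Icc 0 T) t := by
  have c0 := fB_cont
  have h1 := conv_hasDeriv (fB 1) (fB (n + 1)) (fun x => fB n x + fB (n + 2) x) (c0 1)
    (fB_hasDeriv n) ((c0 n).add (c0 (n + 2))) (fB_zero n) T t ht
  have h2 := conv_hasDeriv (fB 0) (fB (n + 2)) (fun x => fB (n + 1) x + fB (n + 3) x) (c0 0)
    (fB_hasDeriv (n + 1)) ((c0 (n + 1)).add (c0 (n + 3))) (fB_zero (n + 1)) T t ht
  have h := h1.sub h2
  have ii : ∀ a b : ℕ, IntervalIntegrable (fun τ => fB a (t - τ) * fB b τ) volume 0 t := by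
    intro a b
    apply Continuous.intervalIntegrable
    exact ((c0 a).comp (continuous_const.sub continuous_id)).mul (c0 b)
  simp only [mul_add] at h
  rw [integral_add (ii _ _) (ii _ _), integral_add (ii _ _) (ii _ _)] at h
  refine h.congr_deriv ?_
  simp only [W]
  ring

theorem W_init (n : ℕ) : W n 0 = 0 := by simp [W]

theorem W_bound (T : ℝ) : ∃ C, ∀ n, ∀ t ∈ Icc 0 T, |W n t| ≤ C := by
  set M := Real.exp T * Real.exp T with hM
  refine ⟨M * M * T + M * M * T, fun n t ht => ?_⟩
  have b : ∀ a b : ℕ, |∫ τ in (0:ℝ)..t, fB a (t - τ) * fB b τ| ≤ M * M * T := by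
    intro a b
    have := intervalIntegral.norm_integral_le_of_norm_le_const (a := 0) (b := t)
      (f := fun τ => fB a (t - τ) * fB b τ) (C := M * M) ?_
    · rw [Real.norm_eq_abs, sub_zero, abs_of_nonneg ht.1] at this
      exact this.trans (mul_le_mul_of_nonneg_left ht.2 (by positivity))
    · intro τ hτ
      rw [uIoc_of_le ht.1] at hτ
      have h1 := hτ.1
      have h2 := hτ.2
      have h3 := ht.2
      rw [Real.norm_eq_abs, abs_mul]
      apply mul_le_mul (fB_abs_le _ _) (fB_abs_le _ _) (abs_nonneg _) (by positivity)
      · rw [abs_of_nonneg] <;> linarith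
      · rw [abs_of_nonneg] <;> linarith
  exact (abs_sub _ _).trans (add_le_add (b _ _) (b _ _))

theorem W_iter (T C : ℝ) (hC : ∀ n, ∀ t ∈ Icc 0 T, |W n t| ≤ C) (hC0 : 0 ≤ C) (m : ℕ) :
    ∀ n, ∀ t ∈ Icc 0 T, |W n t| ≤ C * ep m (2 * t) := by
  induction m with
  | zero => simpa [ep] using hC
  | succ m ih =>
    intro n
    cases n with
    | zero =>
      intro t ht
      rw [W_zero, abs_zero]
      exact mul_nonneg hC0 (ep_nonneg _ (by linarith [ht.1]))
    | succ n =>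
      intro t ht
      apply image_norm_le_of_norm_deriv_right_le_deriv_boundary (f := W (n + 1))
        (f' := fun t => W n t + W (n + 2) t) (a := 0) (b := T)
        (B := fun t => C * ep (m + 1) (2 * t)) (B' := fun t => C * (ep m (2 * t) * 2))
      · exact fun t ht => (W_hasDeriv n ht).continuousWithinAt
      · exact fun t ht => (W_hasDeriv n (Ico_subset_Icc_self ht)).mono_of_mem_nhdsWithin
          (Icc_mem_nhdsGE_of_mem ht)
      · simp [W_init, ep]
      · intro x
        apply HasDerivAt.const_mul
        have h2 : HasDerivAt (fun x : ℝ => 2 * x) 2 x := by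
          simpa using (hasDerivAt_id x).const_mul (2:ℝ)
        exact (ep_hasDeriv (m + 1) (2 * x)).comp x h2
      · intro x hx
        have hx' := Ico_subset_Icc_self hx
        refine (norm_add_le _ _).trans ?_
        have h1 := ih n x hx'
        have h2 := ih (n + 2) x hx'
        simp only [Real.norm_eq_abs]
        linarith
      · exact ht

theorem W_eq_zero (n : ℕ) (t : ℝ) (ht : 0 ≤ t) : W n t = 0 := by
  obtain ⟨C, hC⟩ := W_bound t
  have hm : t ∈ Icc 0 t := ⟨ht, le_rfl⟩
  have hC0 : 0 ≤ C := (abs_nonneg _).trans (hC n t hm)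
  have hl := ((ep_summable (2 * t)).tendsto_atTop_zero).const_mul C
  rw [mul_zero] at hl
  have := ge_of_tendsto' hl fun m => W_iter t C hC hC0 m n t hm
  exact abs_nonpos_iff.1 this

/-- For every integer `y ≥ 1` and real `t ≥ 0`:
`∫_0^t (I_1(2(t−τ)) I_{y−1}(2τ) − I_0(2(t−τ)) I_y(2τ)) dτ = 0`. -/
theorem besselI_convolution_vanishes (y : ℕ) (hy : 1 ≤ y) (t : ℝ) (ht : 0 ≤ t) :
    ∫ τ in (0:ℝ)..t,
      (besselI 1 (2 * (t - τ)) * besselI (y - 1) (2 * τ) -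
        besselI 0 (2 * (t - τ)) * besselI y (2 * τ)) = 0 := by
  obtain ⟨n, rfl⟩ : ∃ n, y = n + 1 := ⟨y - 1, by omega⟩
  simp only [besselI_eq_s19, Nat.add_sub_cancel]
  have c0 := fB_cont
  have ii : ∀ a b : ℕ, IntervalIntegrable (fun τ => fB a (t - τ) * fB b τ) volume 0 t := by
    intro a b
    apply Continuous.intervalIntegrable
    exact ((c0 a).comp (continuous_const.sub continuous_id)).mul (c0 b)
  rw [integral_sub (ii _ _) (ii _ _)]
  exact W_eq_zero n t ht
end
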